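/- Let f(t,s,r)=γ(t)+sX(t)+rY(t) be a pseudo-non-degenerate two-ruled hypersurface in ℝ⁴ (normalized, with functions a,b₁,b₂,b₃,b₄), and let p=(0,s,r) be a singular point of f (so b₄(0)=0 and b₃(0)+s+ra(0)=0). Then f at p is a Whitney umbrella × interval (A-equivalent to (t,s,r)↦(t,s,r²,tr)) if and only if b₄ is not identically zero near 0 and b₄'(0)≠0. -/

import Mathlib

open scoped Topology
open Filter

noncomputable section

/-- Ambient space `ℝ⁴`. -/
abbrev E4 := Fin 4 → ℝ

/-- The standard inner product on `ℝ⁴`. -/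
def dot4 (u v : E4) : ℝ := ∑ i, u i * v i

/-- `det(u,v,w,x)` for four vectors of `ℝ⁴`. -/
def det4 (u v w x : E4) : ℝ := Matrix.det (Matrix.of ![u, v, w, x])

/-- The triple exterior (cross) product `u ∧ v ∧ w` in `ℝ⁴`. -/
def tcross (u v w : E4) : E4 := fun i => det4 (Pi.single i 1) u v w

/-- A diffeomorphism-germ at `p`: smooth at `p` with invertible differential. -/
def IsDiffeoGermAt {E : Type*} [NormedAddCommGroup E] [NormedSpace ℝ E]
    (φ : E → E) (p : E) : Prop :=
  ContDiffAt ℝ (⊤ : ℕ∞) φ p ∧ Function.Bijective (fderiv ℝ φ p)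

/-- `f` at `p` is 𝒜-equivalent to the germ of `g` at `0`. -/
def AEquivAt (f : ℝ × ℝ × ℝ → E4) (p : ℝ × ℝ × ℝ) (g : ℝ × ℝ × ℝ → E4) : Prop :=
  ∃ (φ : ℝ × ℝ × ℝ → ℝ × ℝ × ℝ) (Φ : E4 → E4),
    IsDiffeoGermAt φ p ∧ IsDiffeoGermAt Φ (f p) ∧
    φ p = 0 ∧ Φ (f p) = g 0 ∧ ∀ᶠ q in 𝓝 p, Φ (f q) = g (φ q)

section Helpers

open scoped ContDiff

/-- all derivatives are bounded -/
def BddDerivs {H : Type*} [NormedAddCommGroup H] [NormedSpace ℝ H] (h : H → ℂ) : Prop :=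
  ContDiff ℝ ∞ h ∧ ∀ j : ℕ, ∃ C : ℝ, 0 ≤ C ∧ ∀ x, ‖iteratedFDeriv ℝ j h x‖ ≤ C

theorem contDiff_param_integral {V H α : Type*} [NormedAddCommGroup V] [NormedSpace ℝ V]
    [NormedAddCommGroup H] [NormedSpace ℝ H] [TopologicalSpace α] [SecondCountableTopology α]
    [TopologicalSpace.PseudoMetrizableSpace α] [MeasurableSpace α] [OpensMeasurableSpace α]
    (μ : MeasureTheory.Measure α) (w : α → ℂ) (L : α → V →L[ℝ] H) (h : H → ℂ)
    (hh : BddDerivs h) (hwc : Continuous w) (hL : Continuous L)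
    (hintg : ∀ j : ℕ, MeasureTheory.Integrable (fun z => ‖w z‖ * ‖L z‖ ^ j) μ) :
    ContDiff ℝ ∞ (fun v => ∫ z, w z • h (L z v) ∂μ) := by
  obtain ⟨hs, hb⟩ := hh
  choose C hC0 hC using hb
  set T : (j : ℕ) → V → α → (V [×j]→L[ℝ] ℂ) :=
    fun j v z => w z • iteratedFDeriv ℝ j (h ∘ L z) v with hT
  have hle : ∀ j : ℕ, (j : WithTop ℕ∞) ≤ ∞ := fun j => by exact_mod_cast le_top
  have hform : ∀ j v z, iteratedFDeriv ℝ j (h ∘ L z) v =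
      (iteratedFDeriv ℝ j h (L z v)).compContinuousLinearMap fun _ => L z := by
    intro j v z
    exact (L z).iteratedFDeriv_comp_right hs v (hle j)
  have hcont : ∀ j v, Continuous (T j v) := by
    intro j v
    simp only [hT, hform]
    refine hwc.smul ?_
    have h1 : Continuous fun z => iteratedFDeriv ℝ j h (L z v) :=
      (hs.continuous_iteratedFDeriv (hle j)).comp (by fun_prop)
    have h2 : Continuous fun z => (fun _ : Fin j => L z) := by fun_prop
    have h3 := (ContinuousMultilinearMap.compContinuousLinearMapContinuousMultilinear ℝ
      (fun _ : Fin j => V) (fun _ : Fin j => H) ℂ).cont.comp h2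
    exact h3.clm_apply h1
  have hnorm : ∀ j v z, ‖T j v z‖ ≤ C j * (‖w z‖ * ‖L z‖ ^ j) := by
    intro j v z
    simp only [hT, hform, norm_smul]
    have h1 := (iteratedFDeriv ℝ j h (L z v)).norm_compContinuousLinearMap_le (fun _ => L z)
    simp only [Finset.prod_const, Finset.card_univ, Fintype.card_fin] at h1
    have h2 := hC j (L z v)
    calc _ ≤ ‖w z‖ * (C j * ‖L z‖ ^ j) := by gcongr; exact h1.trans (by gcongr)
      _ = _ := by ring
  have hTint : ∀ j v, MeasureTheory.Integrable (T j v) μ := fun j v =>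
    ((hintg j).const_mul (C j)).mono' (hcont j v).aestronglyMeasurable
      (Eventually.of_forall (hnorm j v))
  have hder : ∀ j v z, HasFDerivAt (fun v => T j v z) (T (j+1) v z).curryLeft v := by
    intro j v z
    have h1 : ContDiff ℝ ∞ (h ∘ L z) := hs.comp (L z).contDiff
    have h2 := (contDiff_iff_ftaylorSeries.1 h1).fderiv j
      (by exact_mod_cast WithTop.coe_lt_top j) v
    exact h2.const_smul (w z)
  have key : HasFTaylorSeriesUpTo ∞ (fun v => ∫ z, w z • h (L z v) ∂μ)
      (fun v j => ∫ z, T j v z ∂μ) := by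
    refine (hasFTaylorSeriesUpTo_top_iff' le_rfl).2 ?_
    constructor
    · intro v
      simp only [ContinuousMultilinearMap.curry0_apply]
      have := ((continuousMultilinearCurryFin0 ℝ V ℂ).toContinuousLinearEquiv :
        _ →L[ℝ] ℂ).integral_comp_comm (hTint 0 v)
      exact this.symm
    · intro j v
      have h1 := hasFDerivAt_integral_of_dominated_of_fderiv_le (𝕜 := ℝ) (μ := μ)
        (F := T j) (F' := fun v z => (T (j+1) v z).curryLeft) (x₀ := v) (s := Set.univ)
        (bound := fun z => C (j+1) * (‖w z‖ * ‖L z‖ ^ (j+1))) univ_mem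
        (Eventually.of_forall fun v => (hcont j v).aestronglyMeasurable) (hTint j v)
        (((continuousMultilinearCurryLeftEquiv ℝ (fun _ : Fin (j+1) => V) ℂ).continuous.comp
          (hcont (j+1) v)).aestronglyMeasurable)
        (Eventually.of_forall fun z v _ => by
          rw [ContinuousMultilinearMap.curryLeft_norm]; exact hnorm (j+1) v z)
        ((hintg (j+1)).const_mul _)
        (Eventually.of_forall fun z v _ => hder j v z)

      let e : (V [×(j+1)]→L[ℝ] ℂ) →L[ℝ] (V →L[ℝ] (V [×j]→L[ℝ] ℂ)) :=
        (continuousMultilinearCurryLeftEquiv ℝ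
          (fun _ : Fin (j+1) => V) ℂ).toContinuousLinearEquiv.toContinuousLinearMap
      have := ContinuousLinearMap.integral_comp_comm (𝕜 := ℝ) (μ := μ) (Fₗ := V →L[ℝ] (V [×j]→L[ℝ] ℂ)) e (hTint (j+1) v)
      exact h1.congr_fderiv this
  exact key.contDiff

theorem exists_cos_sqrt : ∃ C : ℝ → ℝ, ContDiff ℝ ∞ C ∧ ∀ x, C (x ^ 2) = Real.cos x := by
  set c : ℕ → ℝ := fun n => (-1) ^ n / (2 * n).factorial with hc
  have hrad : (FormalMultilinearSeries.ofScalars ℝ c).radius = ⊤ := by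
    apply FormalMultilinearSeries.ofScalars_radius_eq_top_of_tendsto
    · refine Eventually.of_forall fun n => ?_
      simp only [hc]; positivity
    · have h1 : ∀ n : ℕ, ‖c n.succ‖ / ‖c n‖ = 1 / ((2 * n + 2) * (2 * n + 1)) := by
        intro n
        simp only [hc, norm_div, norm_pow, norm_neg, norm_one, one_pow, Nat.succ_eq_add_one]
        rw [show 2 * (n + 1) = 2 * n + 1 + 1 by ring, Nat.factorial_succ, Nat.factorial_succ]
        push_cast
        have : ((2 * n).factorial : ℝ) ≠ 0 := by positivity
        simp only [norm_mul, Real.norm_eq_abs]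
        rw [abs_of_pos (by positivity), abs_of_pos (by positivity), abs_of_pos (by positivity)]
        field_simp
        ring
      simp only [h1]
      refine squeeze_zero (fun n => by positivity) (fun n => ?_)
        tendsto_one_div_add_atTop_nhds_zero_nat
      apply one_div_le_one_div_of_le (by positivity)
      nlinarith [(Nat.cast_nonneg n : (0:ℝ) ≤ n)]
  refine ⟨FormalMultilinearSeries.ofScalarsSum c, ?_, ?_⟩
  · have h := (FormalMultilinearSeries.ofScalars ℝ c).hasFPowerSeriesOnBall (by rw [hrad]; simp)
    rw [hrad] at h
    have h2 := h.analyticOnNhd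
    rw [contDiff_iff_contDiffAt]
    intro x
    exact (h2 x (by simp)).contDiffAt
  · intro x
    rw [FormalMultilinearSeries.ofScalarsSum_eq_tsum]
    rw [(Real.hasSum_cos x).tsum_eq.symm]
    refine tsum_congr fun n => ?_
    simp only [hc, smul_eq_mul]
    rw [← pow_mul]; ring

theorem cos_sqrt_bdd (C : ℝ → ℝ) (hC : ContDiff ℝ ∞ C) (hcos : ∀ x, C (x ^ 2) = Real.cos x) (j : ℕ) :
    ∀ w, 0 ≤ w → |iteratedDeriv j C w| ≤ |iteratedDeriv j C 0| := by
  set D : ℕ → ℝ → ℝ := fun j x => iteratedDeriv j C (x ^ 2) with hD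
  have hdiff : ∀ j, Differentiable ℝ (iteratedDeriv j C) := fun j =>
    hC.differentiable_iteratedDeriv j (by exact_mod_cast WithTop.coe_lt_top j)
  have hDd : ∀ j x, HasDerivAt (D j) (2 * x * D (j+1) x) x := by
    intro j x
    have h1 : HasDerivAt (iteratedDeriv j C) (iteratedDeriv (j+1) C (x^2)) (x^2) := by
      rw [iteratedDeriv_succ]; exact (hdiff j _).hasDerivAt
    have h2 := HasDerivAt.comp (h₂ := iteratedDeriv j C) (h := fun x : ℝ => x ^ 2) x h1
      (hasDerivAt_pow 2 x)
    refine h2.congr_deriv ?_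
    simp [hD]; ring
  have hcontD : ∀ j, Continuous (D j) := fun j => by
    have : Differentiable ℝ (D j) := fun x => (hDd j x).differentiableAt
    exact this.continuous
  have ode : ∀ (j : ℕ) x, 4 * x ^ 2 * D (j+2) x + (4 * j + 2) * D (j+1) x + D j x = 0 := by
    intro j
    induction j with
    | zero =>
      intro x
      have h0 : D 0 = Real.cos := by funext x; simp [hD, hcos]
      have h1 : ∀ x, 2 * x * D 1 x = - Real.sin x := by
        intro x
        have := hDd 0 x
        rw [h0] at this
        exact this.unique (Real.hasDerivAt_cos x)
      have h2 : HasDerivAt (fun x => 2 * x * D 1 x) (2 * D 1 x + 2 * x * (2 * x * D 2 x)) x := by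
        have := ((hasDerivAt_id x).const_mul 2).mul (hDd 1 x)
        refine this.congr_deriv ?_
        simp
      have h3 : HasDerivAt (fun x => 2 * x * D 1 x) (- Real.cos x) x := by
        rw [funext h1]; exact (Real.hasDerivAt_sin x).neg
      have h4 := h2.unique h3
      rw [h0]
      push_cast
      linarith
    | succ j ih =>
      have hx : ∀ x, 2 * x * (4 * x ^ 2 * D (j+3) x + (4 * (j+1) + 2) * D (j+2) x + D (j+1) x) = 0 := by
        intro x
        have h1 : HasDerivAt (fun x => 4 * x ^ 2 * D (j+2) x + (4 * j + 2) * D (j+1) x + D j x)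
            ((4 * (2 * x)) * D (j+2) x + 4 * x ^ 2 * (2 * x * D (j+3) x)
              + (4 * j + 2) * (2 * x * D (j+2) x) + 2 * x * D (j+1) x) x := by
          have := (((((hasDerivAt_pow 2 x).const_mul 4).mul (hDd (j+2) x)).add
            ((hDd (j+1) x).const_mul (4 * j + 2 : ℝ))).add (hDd j x))
          refine this.congr_deriv ?_
          push_cast
          ring
        have h2 : HasDerivAt (fun x => 4 * x ^ 2 * D (j+2) x + (4 * j + 2) * D (j+1) x + D j x) 0 x := by
          rw [funext ih]; exact hasDerivAt_const x 0
        have := h1.unique h2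
        linarith
      have hne : ∀ x, x ≠ 0 →
          (4 * x ^ 2 * D (j+3) x + (4 * (j+1) + 2) * D (j+2) x + D (j+1) x) = 0 := by
        intro x h0
        have := hx x
        simpa [h0] using this
      have hc : Continuous fun x => 4 * x ^ 2 * D (j+3) x + (4 * (j+1) + 2) * D (j+2) x + D (j+1) x := by
        have := hcontD (j+1); have := hcontD (j+2); have := hcontD (j+3); fun_prop
      have := Continuous.ext_on (dense_compl_singleton (0:ℝ)) hc continuous_const
        (fun x hx => hne x hx)
      intro x
      have := congrFun this x
      push_cast
      exact this
  have hE : AntitoneOn (fun x => D j x ^ 2 + 4 * x ^ 2 * D (j+1) x ^ 2) (Set.Ici 0) := by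
    have hd : ∀ x, HasDerivAt (fun x => D j x ^ 2 + 4 * x ^ 2 * D (j+1) x ^ 2)
        (-16 * j * x * D (j+1) x ^ 2) x := by
      intro x
      have := ((hDd j x).pow 2).add
        (((hasDerivAt_pow 2 x).const_mul 4).mul ((hDd (j+1) x).pow 2))
      refine this.congr_deriv ?_
      have h := ode j x
      simp only [Nat.cast_ofNat, Nat.add_one_sub_one, pow_one, Pi.pow_apply]
      linear_combination (4 * x * D (j+1) x) * h
    apply antitoneOn_of_deriv_nonpos (convex_Ici 0)
    · exact (continuous_iff_continuousAt.2 fun x => (hd x).continuousAt).continuousOn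
    · exact fun x _ => (hd x).differentiableAt.differentiableWithinAt
    · intro x hx
      simp at hx
      rw [(hd x).deriv]
      have : 0 ≤ 16 * (j:ℝ) * x * D (j+1) x ^ 2 := by positivity
      linarith
  intro w hw
  have h1 := hE (a := 0) (b := Real.sqrt w) (by simp) (by simp) (Real.sqrt_nonneg w)
  simp only [hD, Real.sq_sqrt hw] at h1
  rw [← sq_le_sq]
  have : 0 ≤ w * iteratedDeriv (j+1) C w ^ 2 := by positivity
  simp at h1
  nlinarith

/-- cut off on the negative side -/
theorem exists_bdd_ext (C : ℝ → ℝ) (hC : ContDiff ℝ ∞ C)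
    (hb : ∀ j : ℕ, ∃ M, ∀ w, 0 ≤ w → |iteratedDeriv j C w| ≤ M) :
    ∃ k : ℝ → ℝ, ContDiff ℝ ∞ k ∧ (∀ w, 0 ≤ w → k w = C w) ∧
      ∀ j : ℕ, ∃ M, ∀ w, |iteratedDeriv j k w| ≤ M := by
  set k : ℝ → ℝ := fun x => Real.smoothTransition (x + 2) * C x with hk
  have hks : ContDiff ℝ ∞ k := by
    apply ContDiff.mul _ hC
    exact Real.smoothTransition.contDiff.comp (contDiff_id.add contDiff_const)
  refine ⟨k, hks, fun w hw => ?_, fun j => ?_⟩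
  · simp only [hk]
    rw [Real.smoothTransition.one_of_one_le (by linarith), one_mul]
  · obtain ⟨M, hM⟩ := hb j
    have hcont : Continuous (iteratedDeriv j k) :=
      hks.continuous_iteratedDeriv j (by exact_mod_cast le_top)
    obtain ⟨M', hM'⟩ := (isCompact_Icc (a := (-3:ℝ)) (b := 0)).exists_bound_of_continuousOn
      hcont.continuousOn
    refine ⟨max M (max M' 0), fun w => ?_⟩
    rcases lt_or_ge w (-3) with h | h
    · have : k =ᶠ[𝓝 w] fun _ => 0 := by
        filter_upwards [eventually_lt_nhds h] with x hx
        simp only [hk]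
        rw [Real.smoothTransition.zero_of_nonpos (by linarith), zero_mul]
      rw [this.iteratedDeriv_eq]
      have h0 : iteratedDeriv j (fun _ : ℝ => (0:ℝ)) w = 0 := by
        simp
      rw [h0]; simp
    rcases le_or_gt w 0 with h' | h'
    · have := hM' w ⟨h, h'⟩
      exact le_max_of_le_right (le_max_of_le_left this)
    · have : k =ᶠ[𝓝 w] C := by
        filter_upwards [eventually_gt_nhds h'] with x hx
        simp only [hk]
        rw [Real.smoothTransition.one_of_one_le (by linarith), one_mul]
      rw [this.iteratedDeriv_eq]
      exact le_max_of_le_left (hM w h'.le)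

theorem exists_kl : ∃ k l : ℝ → ℝ, ContDiff ℝ ∞ k ∧ ContDiff ℝ ∞ l ∧
    (∀ x, k (x ^ 2) = Real.cos x) ∧ (∀ x, x * l (x ^ 2) = Real.sin x) ∧
    (∀ j : ℕ, ∃ M, ∀ w, |iteratedDeriv j k w| ≤ M) ∧
    (∀ j : ℕ, ∃ M, ∀ w, |iteratedDeriv j l w| ≤ M) := by
  obtain ⟨C, hC, hcos⟩ := exists_cos_sqrt
  have hb := cos_sqrt_bdd C hC hcos
  obtain ⟨k, hk, hkC, hkb⟩ := exists_bdd_ext C hC fun j => ⟨_, hb j⟩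
  have hC' : ContDiff ℝ ∞ (deriv C) := by
    have : ContDiff ℝ (∞ + 1) C := hC
    exact (contDiff_succ_iff_deriv.1 this).2.2
  obtain ⟨l, hl, hlC, hlb⟩ := exists_bdd_ext (deriv C) hC' fun j => ⟨_, fun w hw => by
    have := hb (j+1) w hw
    rw [iteratedDeriv_succ'] at this; exact this⟩
  refine ⟨k, fun x => (-2) * l x, hk, contDiff_const.mul hl, fun x => ?_, fun x => ?_, hkb, fun j => ?_⟩
  · rw [hkC _ (sq_nonneg x), hcos]
  · change x * (-2 * l (x ^ 2)) = Real.sin x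
    rw [hlC _ (sq_nonneg x)]
    have h1 : HasDerivAt (fun x => C (x ^ 2)) (deriv C (x ^ 2) * (2 * x)) x := by
      have := ((hC.differentiable (by simp)) (x^2)).hasDerivAt.comp x (h := fun x : ℝ => x ^ 2)
        (hasDerivAt_pow 2 x)
      exact this.congr_deriv (by simp)
    rw [funext hcos] at h1
    have := h1.unique (Real.hasDerivAt_cos x)
    linarith
  · obtain ⟨M, hM⟩ := hlb j
    refine ⟨2 * M, fun w => ?_⟩
    have : iteratedDeriv j (fun x => (-2) * l x) w = (-2) * iteratedDeriv j l w := by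
      apply iteratedDeriv_const_mul_field
    rw [this, abs_mul]
    have := hM w
    norm_num
    exact this

theorem BddDerivs.comp_clm {H H' : Type*} [NormedAddCommGroup H] [NormedSpace ℝ H]
    [NormedAddCommGroup H'] [NormedSpace ℝ H'] {h : H → ℂ} (hh : BddDerivs h) (L : H' →L[ℝ] H) :
    BddDerivs (fun x => h (L x)) := by
  refine ⟨hh.1.comp L.contDiff, fun j => ?_⟩
  obtain ⟨C, hC0, hC⟩ := hh.2 j
  refine ⟨C * ‖L‖ ^ j, by positivity, fun x => ?_⟩
  have := L.iteratedFDeriv_comp_right hh.1 x (i := j) (by exact_mod_cast le_top)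
  have h1 := (iteratedFDeriv ℝ j h (L x)).norm_compContinuousLinearMap_le (fun _ => L)
  simp only [Finset.prod_const, Finset.card_univ, Fintype.card_fin] at h1
  rw [← this] at h1
  refine h1.trans ?_
  gcongr
  exact hC _

theorem BddDerivs.mul {H : Type*} [NormedAddCommGroup H] [NormedSpace ℝ H]
    {f g : H → ℂ} (hf : BddDerivs f) (hg : BddDerivs g) :
    BddDerivs (fun x => f x * g x) := by
  refine ⟨hf.1.mul hg.1, fun j => ?_⟩
  choose C hC0 hC using hf.2
  choose C' hC0' hC' using hg.2
  refine ⟨∑ i ∈ Finset.range (j+1), (j.choose i : ℝ) * C i * C' (j - i),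
    Finset.sum_nonneg fun i _ => by have := hC0 i; have := hC0' (j-i); positivity, fun x => ?_⟩
  refine (norm_iteratedFDeriv_mul_le hf.1 hg.1 x (n := j) (by exact_mod_cast le_top)).trans ?_
  gcongr with i hi
  · have := hC0 i; positivity
  · exact hC i x
  · exact hC' _ x

theorem bddDerivs_of_real {k : ℝ → ℝ} (hk : ContDiff ℝ ∞ k)
    (hb : ∀ j : ℕ, ∃ M, ∀ w, |iteratedDeriv j k w| ≤ M) :
    BddDerivs (fun x => (k x : ℂ)) := by
  refine ⟨Complex.ofRealCLM.contDiff.comp hk, fun j => ?_⟩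
  obtain ⟨M, hM⟩ := hb j
  refine ⟨M, (abs_nonneg _).trans (hM 0), fun x => ?_⟩
  have h1 : (fun x => (k x : ℂ)) = Complex.ofRealLI ∘ k := rfl
  rw [h1, LinearIsometry.norm_iteratedFDeriv_comp_left _ hk.contDiffAt (by exact_mod_cast le_top),
    norm_iteratedFDeriv_eq_norm_iteratedDeriv]
  exact hM x

theorem bddDerivs_exp : BddDerivs (fun a : ℝ => Complex.exp (a * Complex.I)) := by
  have hs : ContDiff ℝ ∞ (fun a : ℝ => Complex.exp (a * Complex.I)) :=
    Complex.contDiff_exp.comp (Complex.ofRealCLM.contDiff.mul contDiff_const)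
  refine ⟨hs, fun j => ⟨1, zero_le_one, fun x => ?_⟩⟩
  rw [norm_iteratedFDeriv_eq_norm_iteratedDeriv]
  have : ∀ j : ℕ, iteratedDeriv j (fun a : ℝ => Complex.exp (a * Complex.I)) =
      fun a : ℝ => Complex.I ^ j * Complex.exp (a * Complex.I) := by
    intro j
    induction j with
    | zero => simp
    | succ j ih =>
      rw [iteratedDeriv_succ, ih]
      funext a
      have h1 : HasDerivAt (fun a : ℝ => Complex.exp (a * Complex.I))
          (Complex.exp (a * Complex.I) * Complex.I) a := by
        have h2 : HasDerivAt (fun a : ℝ => (a : ℂ) * Complex.I) Complex.I a := by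
          simpa using (Complex.ofRealCLM.hasDerivAt (x := a)).mul_const Complex.I
        exact h2.cexp
      rw [(h1.const_mul _).deriv, pow_succ]; ring
  rw [this]
  simp [Complex.norm_exp_ofReal_mul_I]

/-- Whitney decomposition for compactly supported functions. -/
theorem whitney_compact (Q : ℝ × ℝ × ℝ → ℝ) (hQ : ContDiff ℝ ∞ Q) (hQc : HasCompactSupport Q) :
    ∃ A B : ℝ × ℝ × ℝ → ℝ, ContDiff ℝ ∞ A ∧ ContDiff ℝ ∞ B ∧
      ∀ u v x, Q (u, v, x) = A (u, v, x ^ 2) + x * B (u, v, x ^ 2) := by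
  let e0 : EuclideanSpace ℝ (Fin 3) ≃ₗ[ℝ] ℝ × ℝ × ℝ :=
    { toFun := fun y => (y 0, y 1, y 2)
      invFun := fun p => !₂[p.1, p.2.1, p.2.2]
      map_add' := by intro x y; simp
      map_smul' := by intro c x; simp
      left_inv := by intro x; ext i; fin_cases i <;> simp
      right_inv := by intro p; simp }
  let e := e0.toContinuousLinearEquiv
  have he : ∀ u v x, e !₂[u, v, x] = (u, v, x) := by
    intro u v x
    exact e0.right_inv (u, v, x)
  let f : EuclideanSpace ℝ (Fin 3) → ℂ := fun y => ((Q (e y) : ℝ) : ℂ)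
  have hf : ContDiff ℝ ∞ f := Complex.ofRealCLM.contDiff.comp (hQ.comp e.contDiff)
  have hfc : HasCompactSupport f := by
    have h1 : HasCompactSupport (Q ∘ e) := hQc.comp_homeomorph e.toHomeomorph
    exact h1.comp_left (g := fun r : ℝ => (r : ℂ)) (by simp)
  let S : SchwartzMap (EuclideanSpace ℝ (Fin 3)) ℂ := hfc.toSchwartzMap hf
  let w : SchwartzMap (EuclideanSpace ℝ (Fin 3)) ℂ := FourierTransform.fourier S
  have hinv : ∀ y, (Q (e y) : ℂ) =
      ∫ z, Complex.exp ((↑(2 * Real.pi * inner ℝ z y) * Complex.I)) • w z := by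
    intro y
    rw [← Real.fourierInv_eq' (fun z => w z) y]
    have h1 : FourierTransformInv.fourierInv (FourierTransform.fourier S) = S :=
      FourierTransform.fourierInv_fourier_eq S
    have h2 := congrArg (fun T : SchwartzMap (EuclideanSpace ℝ (Fin 3)) ℂ => T y) h1
    simp only [SchwartzMap.fourierInv_coe] at h2
    exact h2.symm
  obtain ⟨k, l, hk, hl, hkc, hls, hkb, hlb⟩ := exists_kl
  have hKb : BddDerivs fun p : ℝ × ℝ => Complex.exp (p.1 * Complex.I) * (k p.2 : ℂ) :=
    (bddDerivs_exp.comp_clm (ContinuousLinearMap.fst ℝ ℝ ℝ)).mul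
      ((bddDerivs_of_real hk hkb).comp_clm (ContinuousLinearMap.snd ℝ ℝ ℝ))
  have hLb : BddDerivs fun p : ℝ × ℝ => Complex.exp (p.1 * Complex.I) * (l p.2 : ℂ) :=
    (bddDerivs_exp.comp_clm (ContinuousLinearMap.fst ℝ ℝ ℝ)).mul
      ((bddDerivs_of_real hl hlb).comp_clm (ContinuousLinearMap.snd ℝ ℝ ℝ))
  let M1 : ℝ × ℝ × ℝ →L[ℝ] ℝ × ℝ :=
    (ContinuousLinearMap.inl ℝ ℝ ℝ).comp (ContinuousLinearMap.fst ℝ ℝ (ℝ × ℝ))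
  let M2 : ℝ × ℝ × ℝ →L[ℝ] ℝ × ℝ :=
    (ContinuousLinearMap.inl ℝ ℝ ℝ).comp
      ((ContinuousLinearMap.fst ℝ ℝ ℝ).comp (ContinuousLinearMap.snd ℝ ℝ (ℝ × ℝ)))
  let M3 : ℝ × ℝ × ℝ →L[ℝ] ℝ × ℝ :=
    (ContinuousLinearMap.inr ℝ ℝ ℝ).comp
      ((ContinuousLinearMap.snd ℝ ℝ ℝ).comp (ContinuousLinearMap.snd ℝ ℝ (ℝ × ℝ)))
  let L : EuclideanSpace ℝ (Fin 3) → ℝ × ℝ × ℝ →L[ℝ] ℝ × ℝ := fun z =>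
    (2 * Real.pi * z 0) • M1 + (2 * Real.pi * z 1) • M2 + ((2 * Real.pi * z 2) ^ 2) • M3
  have hLapp : ∀ z u v y, L z (u, v, y) =
      (2 * Real.pi * z 0 * u + 2 * Real.pi * z 1 * v, (2 * Real.pi * z 2) ^ 2 * y) := by
    intro z u v y
    simp [L, M1, M2, M3]
  have hLc : Continuous L := by
    simp only [L]
    fun_prop
  set K : ℝ := 2 * Real.pi * ‖M1‖ + 2 * Real.pi * ‖M2‖ + (2 * Real.pi) ^ 2 * ‖M3‖ with hK
  have hpi := Real.pi_pos
  have hK0 : 0 ≤ K := by positivity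
  have hzi : ∀ (z : EuclideanSpace ℝ (Fin 3)) i, |z i| ≤ ‖z‖ := fun z i => by
    simpa using PiLp.norm_apply_le z i
  have hLn : ∀ z, ‖L z‖ ≤ K * (1 + ‖z‖ ^ 2) := by
    intro z
    have h0 := hzi z 0
    have h1 := hzi z 1
    have h2 := hzi z 2
    have hz := norm_nonneg z
    have h3 : ‖z‖ ≤ 1 + ‖z‖ ^ 2 := by nlinarith [sq_nonneg (‖z‖ - 1)]
    have h4 : |z 2| ^ 2 ≤ 1 + ‖z‖ ^ 2 := by
      have := pow_le_pow_left₀ (abs_nonneg _) h2 2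
      linarith
    calc ‖L z‖ ≤ ‖(2 * Real.pi * z 0) • M1‖ + ‖(2 * Real.pi * z 1) • M2‖ +
          ‖((2 * Real.pi * z 2) ^ 2) • M3‖ := norm_add₃_le
      _ = 2 * Real.pi * |z 0| * ‖M1‖ + 2 * Real.pi * |z 1| * ‖M2‖
          + ((2 * Real.pi) ^ 2 * |z 2| ^ 2) * ‖M3‖ := by
        simp only [norm_smul, norm_mul, norm_pow, Real.norm_eq_abs, abs_of_pos hpi, abs_two,
          mul_pow]
      _ ≤ 2 * Real.pi * (1 + ‖z‖ ^ 2) * ‖M1‖ + 2 * Real.pi * (1 + ‖z‖ ^ 2) * ‖M2‖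
          + ((2 * Real.pi) ^ 2 * (1 + ‖z‖ ^ 2)) * ‖M3‖ := by
        gcongr
        · exact h0.trans h3
        · exact h1.trans h3
      _ = K * (1 + ‖z‖ ^ 2) := by rw [hK]; ring
  have hwint : ∀ j : ℕ, MeasureTheory.Integrable (fun z => ‖w z‖ * (1 + ‖z‖ ^ 2) ^ j) := by
    intro j
    simp only [add_pow, one_pow, one_mul, Finset.mul_sum]
    refine MeasureTheory.integrable_finsetSum _ fun i _ => ?_
    have := (w.integrable_pow_mul MeasureTheory.volume (2 * (j - i))).mul_const ((j.choose i : ℝ))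
    refine this.congr (Eventually.of_forall fun z => ?_)
    simp only [pow_mul]; ring
  have hwc : Continuous w := w.continuous
  have hint1 : ∀ j : ℕ, MeasureTheory.Integrable (fun z => ‖w z‖ * ‖L z‖ ^ j) := by
    intro j
    refine ((hwint j).const_mul (K ^ j)).mono' (by
      have : Continuous fun z => ‖w z‖ * ‖L z‖ ^ j := by fun_prop
      exact this.aestronglyMeasurable) (Eventually.of_forall fun z => ?_)
    rw [Real.norm_eq_abs, abs_of_nonneg (by positivity)]
    calc ‖w z‖ * ‖L z‖ ^ j ≤ ‖w z‖ * (K * (1 + ‖z‖ ^ 2)) ^ j := by gcongr; exact hLn z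
      _ = _ := by rw [mul_pow]; ring
  let w2 : EuclideanSpace ℝ (Fin 3) → ℂ := fun z => w z * (Complex.I * ((2 * Real.pi * z 2 : ℝ) : ℂ))
  have hw2c : Continuous w2 := by
    simp only [w2]
    have : Continuous fun z : EuclideanSpace ℝ (Fin 3) => ((2 * Real.pi * z 2 : ℝ) : ℂ) :=
      Complex.continuous_ofReal.comp (by fun_prop)
    fun_prop
  have hint2 : ∀ j : ℕ, MeasureTheory.Integrable (fun z => ‖w2 z‖ * ‖L z‖ ^ j) := by
    intro j
    refine ((hwint (j+1)).const_mul (K ^ j * (2 * Real.pi))).mono' (by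
      have : Continuous fun z => ‖w2 z‖ * ‖L z‖ ^ j := by fun_prop
      exact this.aestronglyMeasurable) (Eventually.of_forall fun z => ?_)
    rw [Real.norm_eq_abs, abs_of_nonneg (by positivity)]
    have hz := norm_nonneg z
    have h3 : |z 2| ≤ 1 + ‖z‖ ^ 2 := by
      have := hzi z 2
      nlinarith [sq_nonneg (‖z‖ - 1)]
    have h4 : ‖w2 z‖ = ‖w z‖ * (2 * Real.pi * |z 2|) := by
      simp only [w2, norm_mul, Complex.norm_I, one_mul, Complex.norm_real, Real.norm_eq_abs,
        abs_of_pos hpi, abs_two]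
    rw [h4]
    calc ‖w z‖ * (2 * Real.pi * |z 2|) * ‖L z‖ ^ j
        ≤ ‖w z‖ * (2 * Real.pi * (1 + ‖z‖ ^ 2)) * (K * (1 + ‖z‖ ^ 2)) ^ j := by
          gcongr; exact hLn z
      _ = _ := by rw [mul_pow]; ring
  have hA := contDiff_param_integral MeasureTheory.volume w L _ hKb hwc hLc hint1
  have hB := contDiff_param_integral MeasureTheory.volume w2 L _ hLb hw2c hLc hint2
  refine ⟨_, _, Complex.reCLM.contDiff.comp hA, Complex.reCLM.contDiff.comp hB, ?_⟩
  intro u v x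
  have hbd : ∀ (h : ℝ × ℝ → ℂ), BddDerivs h → ∀ (W : EuclideanSpace ℝ (Fin 3) → ℂ), Continuous W →
      MeasureTheory.Integrable (fun z => ‖W z‖ * ‖L z‖ ^ 0) → ∀ p,
      MeasureTheory.Integrable (fun z => W z • h (L z p)) := by
    intro h hh W hW hWi p
    obtain ⟨C, hC0, hC⟩ := hh.2 0
    refine (hWi.const_mul C).mono' (by
      have := hh.1.continuous
      have : Continuous fun z => W z • h (L z p) := by fun_prop
      exact this.aestronglyMeasurable) (Eventually.of_forall fun z => ?_)
    have := hC (L z p)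
    rw [norm_iteratedFDeriv_zero] at this
    rw [norm_smul, pow_zero, mul_one, mul_comm]
    gcongr
  have h1 := hinv !₂[u, v, x]
  rw [he] at h1
  have i1 := hbd _ hKb w hwc (hint1 0) (u, v, x ^ 2)
  have i2 := hbd _ hLb w2 hw2c (hint2 0) (u, v, x ^ 2)
  have h2 : (Q (u, v, x) : ℂ) =
      (∫ z, w z • (fun p : ℝ × ℝ => Complex.exp (p.1 * Complex.I) * (k p.2 : ℂ)) (L z (u, v, x ^ 2)))
      + x * (∫ z, w2 z • (fun p : ℝ × ℝ => Complex.exp (p.1 * Complex.I) * (l p.2 : ℂ))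
        (L z (u, v, x ^ 2))) := by
    rw [← MeasureTheory.integral_const_mul, ← MeasureTheory.integral_add i1 (i2.const_mul _), h1]
    refine MeasureTheory.integral_congr_ae (Eventually.of_forall fun z => ?_)
    have hin : inner ℝ z !₂[u, v, x] = z 0 * u + z 1 * v + z 2 * x := by
      simp [PiLp.inner_apply, Fin.sum_univ_three]; ring
    simp only [hin, hLapp, w2, smul_eq_mul]
    rw [← mul_pow, hkc]
    have hs := hls (2 * Real.pi * z 2 * x)
    have hE : Complex.exp (↑(2 * Real.pi * (z 0 * u + z 1 * v + z 2 * x)) * Complex.I) =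
        Complex.exp (↑(2 * Real.pi * z 0 * u + 2 * Real.pi * z 1 * v) * Complex.I) *
        ((Real.cos (2 * Real.pi * z 2 * x) : ℂ) + (Real.sin (2 * Real.pi * z 2 * x) : ℂ) * Complex.I) := by
      rw [Complex.ofReal_cos, Complex.ofReal_sin, ← Complex.exp_mul_I, ← Complex.exp_add]
      congr 1
      push_cast
      ring
    rw [hE, ← hs]
    push_cast
    ring
  have h3 := congrArg Complex.re h2
  rw [Complex.ofReal_re, Complex.add_re, Complex.re_ofReal_mul] at h3
  exact h3

/-- smooth in a neighbourhood of `p` -/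
def SmoothNear {E F : Type*} [NormedAddCommGroup E] [NormedSpace ℝ E]
    [NormedAddCommGroup F] [NormedSpace ℝ F] (f : E → F) (p : E) : Prop :=
  ∀ᶠ q in 𝓝 p, ContDiffAt ℝ ∞ f q

section
variable {E F G : Type*} [NormedAddCommGroup E] [NormedSpace ℝ E]
    [NormedAddCommGroup F] [NormedSpace ℝ F] [NormedAddCommGroup G] [NormedSpace ℝ G]

theorem SmoothNear.at {f : E → F} {p : E} (h : SmoothNear f p) : ContDiffAt ℝ ∞ f p :=
  h.self_of_nhds

theorem SmoothNear.diff {f : E → F} {p : E} (h : SmoothNear f p) : DifferentiableAt ℝ f p :=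
  h.at.differentiableAt (by simp)

theorem ContDiff.smoothNear {f : E → F} (h : ContDiff ℝ ∞ f) (p : E) : SmoothNear f p :=
  Eventually.of_forall fun _ => h.contDiffAt

theorem SmoothNear.comp {f : E → F} {g : F → G} {p : E} (hg : SmoothNear g (f p))
    (hf : SmoothNear f p) : SmoothNear (fun x => g (f x)) p := by
  have := hf.at.continuousAt.eventually hg
  filter_upwards [hf, this] with q h1 h2
  exact h2.comp q h1

theorem SmoothNear.comp' {f : E → F} {g : F → G} {p : E} {y : F} (hg : SmoothNear g y)
    (hf : SmoothNear f p) (hy : f p = y) : SmoothNear (fun x => g (f x)) p := by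
  subst hy; exact hg.comp hf

theorem SmoothNear.prodMk {f : E → F} {g : E → G} {p : E} (hf : SmoothNear f p)
    (hg : SmoothNear g p) : SmoothNear (fun x => (f x, g x)) p := by
  filter_upwards [hf, hg] with q h1 h2 using h1.prodMk h2

theorem SmoothNear.mul {f g : E → ℝ} {p : E} (hf : SmoothNear f p)
    (hg : SmoothNear g p) : SmoothNear (fun x => f x * g x) p := by
  filter_upwards [hf, hg] with q h1 h2 using h1.mul h2

theorem SmoothNear.add {f g : E → F} {p : E} (hf : SmoothNear f p)
    (hg : SmoothNear g p) : SmoothNear (fun x => f x + g x) p := by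
  filter_upwards [hf, hg] with q h1 h2 using h1.add h2

theorem SmoothNear.sub {f g : E → F} {p : E} (hf : SmoothNear f p)
    (hg : SmoothNear g p) : SmoothNear (fun x => f x - g x) p := by
  filter_upwards [hf, hg] with q h1 h2 using h1.sub h2

theorem SmoothNear.div {f g : E → ℝ} {p : E} (hf : SmoothNear f p)
    (hg : SmoothNear g p) (h0 : g p ≠ 0) : SmoothNear (fun x => f x / g x) p := by
  filter_upwards [hf, hg, hg.at.continuousAt.eventually_ne h0] with q h1 h2 h3 using h1.div h2 h3

theorem SmoothNear.fderiv {f : E → F} {p : E} (hf : SmoothNear f p) :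
    SmoothNear (fderiv ℝ f) p := by
  filter_upwards [hf] with q h1
  exact h1.fderiv_right (by simp)

theorem SmoothNear.eventually_diff {f : E → F} {p : E} (h : SmoothNear f p) :
    ∀ᶠ q in 𝓝 p, DifferentiableAt ℝ f q := by
  filter_upwards [h] with q h1 using h1.differentiableAt (by simp)

theorem SmoothNear.eventually_near {f : E → F} {p : E} (h : SmoothNear f p) :
    ∀ᶠ q in 𝓝 p, SmoothNear f q := eventually_eventually_nhds.2 h

end

theorem SmoothNear.exists_cutoff {E F : Type*} [NormedAddCommGroup E] [NormedSpace ℝ E]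
    [FiniteDimensional ℝ E] [NormedAddCommGroup F] [NormedSpace ℝ F] {f : E → F} {p : E}
    (h : SmoothNear f p) :
    ∃ g : E → F, ContDiff ℝ ∞ g ∧ HasCompactSupport g ∧ g =ᶠ[𝓝 p] f := by
  obtain ⟨r, hr, hb⟩ := Metric.eventually_nhds_iff_ball.1 h
  let b : ContDiffBump p := ⟨r / 4, r / 2, by positivity, by linarith⟩
  refine ⟨fun x => b x • f x, ?_, ?_, ?_⟩
  · rw [contDiff_iff_contDiffAt]
    intro x
    by_cases hx : x ∈ Metric.ball p r
    · exact b.contDiff.contDiffAt.smul (hb x hx)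
    · have : (fun x => b x • f x) =ᶠ[𝓝 x] fun _ => 0 := by
        have hx2 : x ∈ (Metric.closedBall p (r/2))ᶜ := by
          simp at hx ⊢; linarith
        filter_upwards [Metric.isClosed_closedBall.isOpen_compl.mem_nhds hx2] with y hy
        have : b y = 0 := by
          apply b.zero_of_le_dist
          simp at hy; exact hy.le
        simp [this]
      exact contDiffAt_const.congr_of_eventuallyEq this
  · exact b.hasCompactSupport.smul_right
  · filter_upwards [b.eventuallyEq_one] with x hx
    simp [hx]

theorem whitney_local (Q : ℝ × ℝ × ℝ → ℝ) (hQ : SmoothNear Q 0) :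
    ∃ A B : ℝ × ℝ × ℝ → ℝ, ContDiff ℝ ∞ A ∧ ContDiff ℝ ∞ B ∧
      ∀ᶠ q in 𝓝 (0 : ℝ × ℝ × ℝ), Q q = A (q.1, q.2.1, q.2.2 ^ 2) + q.2.2 * B (q.1, q.2.1, q.2.2 ^ 2) := by
  obtain ⟨g, hg, hgc, hgQ⟩ := hQ.exists_cutoff
  obtain ⟨A, B, hA, hB, hAB⟩ := whitney_compact g hg hgc
  refine ⟨A, B, hA, hB, ?_⟩
  filter_upwards [hgQ] with q hq
  rw [← hq]
  exact hAB q.1 q.2.1 q.2.2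

theorem bddDerivs_of_compact {H : Type*} [NormedAddCommGroup H] [NormedSpace ℝ H]
    {g : H → ℝ} (hg : ContDiff ℝ ∞ g) (hgc : HasCompactSupport g) :
    BddDerivs fun x => (g x : ℂ) := by
  have hs : ContDiff ℝ ∞ fun x => (g x : ℂ) := Complex.ofRealCLM.contDiff.comp hg
  refine ⟨hs, fun j => ?_⟩
  have hc : HasCompactSupport fun x => (g x : ℂ) :=
    hgc.comp_left (g := fun r : ℝ => (r : ℂ)) (by simp)
  obtain ⟨C, hC⟩ := (hc.iteratedFDeriv (𝕜 := ℝ) j).exists_bound_of_continuous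
    (hs.continuous_iteratedFDeriv (m := j) (by exact_mod_cast le_top))
  exact ⟨C, (norm_nonneg _).trans (hC 0), hC⟩

/-- Hadamard type lemma with double zero. -/
theorem hadamard2 (P lam : ℝ × ℝ × ℝ → ℝ) (hP : SmoothNear P 0) (hl : SmoothNear lam 0)
    (hPl : ∀ᶠ q in 𝓝 (0 : ℝ × ℝ × ℝ), fderiv ℝ P q (0, 0, 1) = q.2.2 * lam q) :
    ∃ m : ℝ × ℝ × ℝ → ℝ, ContDiff ℝ ∞ m ∧ m 0 = lam 0 / 2 ∧
      ∀ᶠ q in 𝓝 (0 : ℝ × ℝ × ℝ), P q = P (q.1, q.2.1, 0) + q.2.2 ^ 2 * m q := by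
  obtain ⟨g, hg, hgc, hgl⟩ := hl.exists_cutoff
  let M1 : ℝ × ℝ × ℝ →L[ℝ] ℝ × ℝ × ℝ :=
    (ContinuousLinearMap.fst ℝ ℝ (ℝ × ℝ)).prod
      (((ContinuousLinearMap.fst ℝ ℝ ℝ).comp (ContinuousLinearMap.snd ℝ ℝ (ℝ × ℝ))).prod 0)
  let M2 : ℝ × ℝ × ℝ →L[ℝ] ℝ × ℝ × ℝ :=
    (0 : ℝ × ℝ × ℝ →L[ℝ] ℝ).prod ((0 : ℝ × ℝ × ℝ →L[ℝ] ℝ).prod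
      ((ContinuousLinearMap.snd ℝ ℝ ℝ).comp (ContinuousLinearMap.snd ℝ ℝ (ℝ × ℝ))))
  let L : ℝ → ℝ × ℝ × ℝ →L[ℝ] ℝ × ℝ × ℝ := fun θ => M1 + θ • M2
  have hLapp : ∀ θ q, L θ q = (q.1, q.2.1, θ * q.2.2) := by
    intro θ q; simp [L, M1, M2]
  have hLc : Continuous L := by simp only [L]; fun_prop
  let μ : MeasureTheory.Measure ℝ := MeasureTheory.volume.restrict (Set.Ioc 0 1)
  have hfin : MeasureTheory.IsFiniteMeasure μ := ⟨by simp [μ]⟩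
  have hm := contDiff_param_integral μ (fun θ : ℝ => (θ : ℂ)) L _ (bddDerivs_of_compact hg hgc)
    Complex.continuous_ofReal hLc (by
      intro j
      have hc : Continuous fun θ : ℝ => ‖(θ : ℂ)‖ * ‖L θ‖ ^ j := by fun_prop
      have := (hc.intervalIntegrable (μ := MeasureTheory.volume) 0 1)
      rw [intervalIntegrable_iff_integrableOn_Ioc_of_le zero_le_one] at this
      exact this)
  have hmr := Complex.reCLM.contDiff.comp hm
  have hmeq : ∀ q, (∫ θ : ℝ, (θ : ℂ) • ((g (L θ q) : ℝ) : ℂ) ∂μ).re =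
      ∫ θ in (0:ℝ)..1, θ * g (q.1, q.2.1, θ * q.2.2) := by
    intro q
    rw [intervalIntegral.integral_of_le zero_le_one]
    have : ∀ θ : ℝ, (θ : ℂ) • ((g (L θ q) : ℝ) : ℂ) = ((θ * g (q.1, q.2.1, θ * q.2.2) : ℝ) : ℂ) := by
      intro θ; rw [hLapp]; simp
    simp only [this]
    rw [integral_complex_ofReal, Complex.ofReal_re]
  refine ⟨_, hmr, ?_, ?_⟩
  · simp only [Function.comp, Complex.reCLM_apply]
    rw [hmeq]
    simp only [Prod.fst_zero, Prod.snd_zero, mul_zero]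
    rw [intervalIntegral.integral_mul_const, integral_id]
    have : g 0 = lam 0 := hgl.self_of_nhds
    rw [show ((0:ℝ), (0:ℝ), (0:ℝ)) = 0 from rfl, this]
    norm_num; ring
  · have hev := hP.and (hPl.and hgl)
    obtain ⟨r, hr, hb⟩ := Metric.eventually_nhds_iff_ball.1 hev
    filter_upwards [Metric.ball_mem_nhds _ hr] with q hq
    simp only [Function.comp, Complex.reCLM_apply]
    rw [hmeq]
    obtain ⟨u, v, x⟩ := q
    simp only
    have hmem : ∀ θ ∈ Set.Icc (0:ℝ) 1, (u, v, θ * x) ∈ Metric.ball (0 : ℝ × ℝ × ℝ) r := by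
      intro θ hθ
      simp only [mem_ball_zero_iff, Prod.norm_def, sup_lt_iff, Real.norm_eq_abs] at hq ⊢
      refine ⟨hq.1, hq.2.1, ?_⟩
      rw [abs_mul, abs_of_nonneg hθ.1]
      have := abs_nonneg x
      have := hθ.2
      have := hq.2.2
      nlinarith
    have hder : ∀ θ ∈ Set.uIcc (0:ℝ) 1, HasDerivAt (fun θ => P (u, v, θ * x))
        (x ^ 2 * (θ * g (u, v, θ * x))) θ := by
      intro θ hθ
      rw [Set.uIcc_of_le zero_le_one] at hθ
      obtain ⟨h1, h2, h3⟩ := hb _ (hmem θ hθ)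
      have hd : HasDerivAt (fun θ : ℝ => (u, v, θ * x)) ((0 : ℝ), (0 : ℝ), x) θ := by
        have := (hasDerivAt_id θ).mul_const x
        simp only [one_mul] at this
        exact (hasDerivAt_const θ u).prodMk ((hasDerivAt_const θ v).prodMk this)
      have h4 := (h1.differentiableAt (by simp)).hasFDerivAt.comp_hasDerivAt θ hd
      refine h4.congr_deriv ?_
      rw [h3]
      have : ((0 : ℝ), (0 : ℝ), x) = x • ((0 : ℝ), (0 : ℝ), (1 : ℝ)) := by simp
      rw [this, map_smul, h2]
      simp only [smul_eq_mul]; ring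
    have hgcont := hg.continuous
    have hI : IntervalIntegrable (fun θ => x ^ 2 * (θ * g (u, v, θ * x)))
        MeasureTheory.volume 0 1 := by
      apply Continuous.intervalIntegrable
      fun_prop
    have := intervalIntegral.integral_eq_sub_of_hasDerivAt hder hI
    rw [intervalIntegral.integral_const_mul] at this
    simp only [one_mul, zero_mul] at this
    linarith

/-- Inverse function theorem. -/
theorem ift {E : Type*} [NormedAddCommGroup E] [NormedSpace ℝ E] [FiniteDimensional ℝ E]
    {Ψ : E → E} {p : E} (hΨ : SmoothNear Ψ p) (hinj : ∀ v, fderiv ℝ Ψ p v = 0 → v = 0) :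
    ∃ Θ : E → E, SmoothNear Θ (Ψ p) ∧ Θ (Ψ p) = p ∧ (∀ᶠ q in 𝓝 p, Θ (Ψ q) = q) ∧
      (∀ᶠ y in 𝓝 (Ψ p), Ψ (Θ y) = y) := by
  have : CompleteSpace E := FiniteDimensional.complete ℝ E
  have hinj' : Function.Injective (fderiv ℝ Ψ p : E →ₗ[ℝ] E) := by
    rw [injective_iff_map_eq_zero]; exact hinj
  let e : E ≃L[ℝ] E := (LinearEquiv.ofInjectiveEndo (fderiv ℝ Ψ p : E →ₗ[ℝ] E) hinj').toContinuousLinearEquiv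
  have he : (e : E →L[ℝ] E) = fderiv ℝ Ψ p := by ext v; rfl
  have hd : HasFDerivAt Ψ (e : E →L[ℝ] E) p := by rw [he]; exact hΨ.diff.hasFDerivAt
  let H := hΨ.at.toOpenPartialHomeomorph Ψ hd (by simp)
  have hH : (H : E → E) = Ψ := hΨ.at.toOpenPartialHomeomorph_coe hd (by simp)
  have hps : p ∈ H.source := hΨ.at.mem_toOpenPartialHomeomorph_source hd (by simp)
  have hpt : Ψ p ∈ H.target := hΨ.at.image_mem_toOpenPartialHomeomorph_target hd (by simp)
  have hinvp : H.symm (Ψ p) = p := by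
    have := H.left_inv hps; rw [hH] at this; exact this
  have hcs : ContinuousAt H.symm (Ψ p) := H.continuousAt_symm hpt
  refine ⟨H.symm, ?_, hinvp, ?_, ?_⟩
  · -- invertibility of the derivative near p
    have hopen : ∀ᶠ q in 𝓝 p, fderiv ℝ Ψ q ∈ Set.range ((↑) : (E ≃L[ℝ] E) → E →L[ℝ] E) := by
      have hc : ContinuousAt (fderiv ℝ Ψ) p := hΨ.fderiv.at.continuousAt
      apply hc.eventually
      have := ContinuousLinearEquiv.nhds e
      rw [he] at this
      exact this
    have h3 : ∀ᶠ y in 𝓝 (Ψ p), ContDiffAt ℝ ∞ Ψ (H.symm y) ∧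
        fderiv ℝ Ψ (H.symm y) ∈ Set.range ((↑) : (E ≃L[ℝ] E) → E →L[ℝ] E) := by
      have : Tendsto H.symm (𝓝 (Ψ p)) (𝓝 p) := by
        have := hcs.tendsto; rwa [hinvp] at this
      exact this.eventually (hΨ.and hopen)
    filter_upwards [h3, H.open_target.mem_nhds hpt] with y ⟨hy1, e', he'⟩ hy2
    apply H.contDiffAt_symm hy2 (f₀' := e')
    · rw [he', hH]; exact (hy1.differentiableAt (by simp)).hasFDerivAt
    · rw [hH]; exact hy1
  · filter_upwards [H.open_source.mem_nhds hps] with q hq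
    have := H.left_inv hq; rw [hH] at this; exact this
  · filter_upwards [H.open_target.mem_nhds hpt] with q hq
    have := H.right_inv hq; rw [hH] at this; exact this

theorem fderiv_comp_near {E F G : Type*} [NormedAddCommGroup E] [NormedSpace ℝ E]
    [NormedAddCommGroup F] [NormedSpace ℝ F] [NormedAddCommGroup G] [NormedSpace ℝ G]
    {g : F → G} {f : E → F} {p : E} {y : F} (hg : SmoothNear g y) (hf : SmoothNear f p)
    (hy : f p = y) :
    ∀ᶠ q in 𝓝 p, ∀ k, fderiv ℝ (fun x => g (f x)) q k = fderiv ℝ g (f q) (fderiv ℝ f q k) := by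
  subst hy
  have h1 := hf.at.continuousAt.eventually hg.eventually_diff
  filter_upwards [h1, hf.eventually_diff] with q h2 h3 k
  have := (h2.hasFDerivAt.comp q h3.hasFDerivAt).fderiv
  have h4 : fderiv ℝ (fun x => g (f x)) q = (fderiv ℝ g (f q)).comp (fderiv ℝ f q) := this
  rw [h4]; rfl

theorem fderiv_triple {E : Type*} [NormedAddCommGroup E] [NormedSpace ℝ E]
    {u v x : E → ℝ} {p : E} (hu : DifferentiableAt ℝ u p) (hv : DifferentiableAt ℝ v p)
    (hx : DifferentiableAt ℝ x p) (k : E) :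
    fderiv ℝ (fun q => (u q, v q, x q)) p k
      = (fderiv ℝ u p k, fderiv ℝ v p k, fderiv ℝ x p k) := by
  have := (hu.hasFDerivAt.prodMk (hv.hasFDerivAt.prodMk hx.hasFDerivAt)).fderiv
  rw [this]; rfl

theorem inv_coords {u v x : ℝ × ℝ × ℝ → ℝ} {p : ℝ × ℝ × ℝ}
    (hu : SmoothNear u p) (hv : SmoothNear v p) (hx : SmoothNear x p)
    (hup : u p = 0) (hvp : v p = 0) (hxp : x p = 0)
    (hinj : ∀ k, fderiv ℝ u p k = 0 → fderiv ℝ v p k = 0 → fderiv ℝ x p k = 0 → k = 0) :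
    ∃ Θ : ℝ × ℝ × ℝ → ℝ × ℝ × ℝ, SmoothNear Θ 0 ∧ Θ 0 = p ∧
      (∀ᶠ q in 𝓝 p, Θ (u q, v q, x q) = q) ∧
      (∀ᶠ y in 𝓝 (0 : ℝ × ℝ × ℝ), u (Θ y) = y.1 ∧ v (Θ y) = y.2.1 ∧ x (Θ y) = y.2.2) ∧
      (∀ᶠ y in 𝓝 (0 : ℝ × ℝ × ℝ), ∀ k, fderiv ℝ u (Θ y) (fderiv ℝ Θ y k) = k.1 ∧
        fderiv ℝ v (Θ y) (fderiv ℝ Θ y k) = k.2.1 ∧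
        fderiv ℝ x (Θ y) (fderiv ℝ Θ y k) = k.2.2) := by
  have hΨ : SmoothNear (fun q => (u q, v q, x q)) p := hu.prodMk (hv.prodMk hx)
  have h0 : (u p, v p, x p) = 0 := by rw [hup, hvp, hxp]; rfl
  obtain ⟨Θ, h1, h2, h3, h4⟩ := ift hΨ (by
    intro k hk
    rw [fderiv_triple hu.diff hv.diff hx.diff] at hk
    simp only [Prod.mk_eq_zero] at hk
    exact hinj k hk.1 hk.2.1 hk.2.2)
  simp only [h0] at h1 h2 h4
  refine ⟨Θ, h1, h2, h3, ?_, ?_⟩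
  · filter_upwards [h4] with y hy
    rw [← hy]
    simp only at hy ⊢
    simp only [hy]; simp
  · have hd := h1.at.continuousAt.tendsto
    rw [h2] at hd
    filter_upwards [eventually_eventually_nhds.2 h4, h1.eventually_diff,
      hd.eventually hu.eventually_diff, hd.eventually hv.eventually_diff,
      hd.eventually hx.eventually_diff] with y hy ht hu' hv' hx' k
    have a1 : HasFDerivAt (fun y => u (Θ y)) ((fderiv ℝ u (Θ y)).comp (fderiv ℝ Θ y)) y :=
      hu'.hasFDerivAt.comp y ht.hasFDerivAt
    have a2 : HasFDerivAt (fun y => v (Θ y)) ((fderiv ℝ v (Θ y)).comp (fderiv ℝ Θ y)) y :=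
      hv'.hasFDerivAt.comp y ht.hasFDerivAt
    have a3 : HasFDerivAt (fun y => x (Θ y)) ((fderiv ℝ x (Θ y)).comp (fderiv ℝ Θ y)) y :=
      hx'.hasFDerivAt.comp y ht.hasFDerivAt
    have a4 := (a1.prodMk (a2.prodMk a3))
    have a5 : HasFDerivAt (fun y => (u (Θ y), v (Θ y), x (Θ y)))
      (ContinuousLinearMap.id ℝ (ℝ × ℝ × ℝ)) y := (hasFDerivAt_id y).congr_of_eventuallyEq hy
    have a6 := DFunLike.congr_fun (a4.unique a5) k
    simp only [ContinuousLinearMap.prod_apply, ContinuousLinearMap.comp_apply,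
      ContinuousLinearMap.id_apply] at a6
    rw [← a6]
    rw [Prod.ext_iff, Prod.ext_iff] at a6
    simp only at a6
    simp only [a6]; simp

theorem core {u v P Q w δ δ2 h τ : ℝ × ℝ × ℝ → ℝ} {p : ℝ × ℝ × ℝ} {c : ℝ}
    (hu : SmoothNear u p) (hv : SmoothNear v p) (hP : SmoothNear P p) (hQ : SmoothNear Q p)
    (hw : SmoothNear w p) (hδ : SmoothNear δ p) (hδ2 : SmoothNear δ2 p) (hh : SmoothNear h p)
    (hτ : SmoothNear τ p)
    (hup : u p = 0) (hvp : v p = 0) (hwp : w p = 0) (hδp : δ p ≠ 0) (hδ2p : δ2 p ≠ 0)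
    (hhp : h p = 0) (hc : c ≠ 0) (hwτ : ∀ k, fderiv ℝ w p k = c * fderiv ℝ τ p k)
    (hinj : ∀ k, fderiv ℝ u p k = 0 → fderiv ℝ v p k = 0 → fderiv ℝ τ p k = 0 → k = 0)
    (H1 : ∀ᶠ q in 𝓝 p, ∀ k, fderiv ℝ u q k = 0 → fderiv ℝ v q k = 0 →
      fderiv ℝ P q k * δ q = fderiv ℝ τ q k * w q)
    (H2 : ∀ᶠ q in 𝓝 p, ∀ k, fderiv ℝ u q k = 0 → fderiv ℝ v q k = 0 →
      fderiv ℝ Q q k * δ2 q = fderiv ℝ τ q k * h q)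
    (H3 : ∀ k, fderiv ℝ u p k = 1 → fderiv ℝ v p k = 0 → fderiv ℝ τ p k = 0 →
      fderiv ℝ h p k ≠ 0) :
    ∃ (ε κ : ℝ) (p0 : ℝ × ℝ → ℝ) (A B : ℝ × ℝ × ℝ → ℝ) (x : ℝ × ℝ × ℝ → ℝ),
      ε * ε = 1 ∧ κ ≠ 0 ∧ SmoothNear p0 0 ∧ ContDiff ℝ ∞ A ∧ ContDiff ℝ ∞ B ∧ SmoothNear x p ∧
      x p = 0 ∧ (∀ k, fderiv ℝ x p k = κ * fderiv ℝ τ p k) ∧ B 0 = 0 ∧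
      fderiv ℝ B 0 (1, 0, 0) ≠ 0 ∧
      (∀ᶠ q in 𝓝 p, P q = p0 (u q, v q) + ε * x q ^ 2) ∧
      (∀ᶠ q in 𝓝 p, Q q = A (u q, v q, x q ^ 2) + x q * B (u q, v q, x q ^ 2)) := by
  -- first coordinate change
  obtain ⟨Θ, t1, t2, t3, t4, t5⟩ := inv_coords hu hv hw hup hvp hwp (by
    intro k k1 k2 k3
    refine hinj k k1 k2 ?_
    rw [hwτ] at k3
    exact (mul_eq_zero.1 k3).resolve_left hc)
  have td := t1.at.continuousAt.tendsto
  rw [t2] at td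
  have hPΘ : SmoothNear (fun y => P (Θ y)) 0 := hP.comp' t1 t2
  have hτΘ : SmoothNear (fun y => τ (Θ y)) 0 := hτ.comp' t1 t2
  have hδΘ : SmoothNear (fun y => δ (Θ y)) 0 := hδ.comp' t1 t2
  have hτx : SmoothNear (fun y => fderiv ℝ (fun y => τ (Θ y)) y (0, 0, 1)) 0 := by
    have := hτΘ.fderiv
    filter_upwards [this] with y hy
    exact hy.clm_apply contDiffAt_const
  obtain ⟨m, hm, hm0, hPm⟩ := hadamard2 (fun y => P (Θ y))
    (fun y => fderiv ℝ (fun y => τ (Θ y)) y (0, 0, 1) / δ (Θ y)) hPΘ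
    (hτx.div hδΘ (by rw [t2]; exact hδp)) (by
      filter_upwards [fderiv_comp_near hP t1 t2, fderiv_comp_near hτ t1 t2, t4, t5,
        td.eventually H1, hδΘ.at.continuousAt.eventually_ne (by rw [t2]; exact hδp)]
        with y y1 y2 y4 y5 y6 y7
      have := y6 (fderiv ℝ Θ y (0, 0, 1)) (y5 _).1 (y5 _).2.1
      rw [y1, y2, ← y4.2.2]
      field_simp
      linarith)
  have hm0' : m 0 ≠ 0 := by
    rw [hm0]
    have h1 := (fderiv_comp_near hτ t1 t2).self_of_nhds (0, 0, 1)
    have h2 := (t5.self_of_nhds (0, 0, 1)).2.2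
    rw [t2, hwτ] at h2
    rw [h1, t2]
    have : fderiv ℝ τ p (fderiv ℝ Θ 0 (0, 0, 1)) ≠ 0 := by
      intro h3; rw [h3] at h2; simp at h2
    positivity
  -- sign
  obtain ⟨ε, hε, hεm⟩ : ∃ ε : ℝ, ε * ε = 1 ∧ 0 < ε * m 0 := by
    rcases lt_or_gt_of_ne hm0' with h | h
    · exact ⟨-1, by norm_num, by linarith⟩
    · exact ⟨1, by norm_num, by linarith⟩
  have hΨ : SmoothNear (fun q => (u q, v q, w q)) p := hu.prodMk (hv.prodMk hw)
  have hΨ0 : (u p, v p, w p) = 0 := by rw [hup, hvp, hwp]; rfl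
  have hmΨ : SmoothNear (fun q => m (u q, v q, w q)) p := (hm.smoothNear _).comp hΨ
  have hsq : SmoothNear (fun q => Real.sqrt (ε * m (u q, v q, w q))) p := by
    have hpos : ∀ᶠ q in 𝓝 p, 0 < ε * m (u q, v q, w q) := by
      have hc : ContinuousAt (fun q => ε * m (u q, v q, w q)) p :=
        hmΨ.at.continuousAt.const_mul ε
      refine hc.eventually (lt_mem_nhds ?_)
      change 0 < ε * m (u p, v p, w p)
      rw [hΨ0]; exact hεm
    filter_upwards [hmΨ, hpos] with q h1 h2
    exact (contDiffAt_const.mul h1).sqrt h2.ne'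
  let x : ℝ × ℝ × ℝ → ℝ := fun q => w q * Real.sqrt (ε * m (u q, v q, w q))
  have hx : SmoothNear x p := hw.mul hsq
  have hxp : x p = 0 := by simp [x, hwp]
  set ρ := Real.sqrt (ε * m 0) with hρ
  have hρ0 : 0 < ρ := Real.sqrt_pos.2 hεm
  have hxd : ∀ k, fderiv ℝ x p k = (c * ρ) * fderiv ℝ τ p k := by
    intro k
    have := (hw.diff.hasFDerivAt.mul hsq.diff.hasFDerivAt).fderiv
    have h2 : fderiv ℝ x p = _ := this
    rw [h2, hΨ0, hwp]
    simp [hwτ]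
    ring
  have hκ : c * ρ ≠ 0 := mul_ne_zero hc hρ0.ne'
  obtain ⟨Ξ, s1, s2, s3, s4, s5⟩ := inv_coords hu hv hx hup hvp hxp (by
    intro k k1 k2 k3
    refine hinj k k1 k2 ?_
    rw [hxd] at k3
    exact (mul_eq_zero.1 k3).resolve_left hκ)
  have sd := s1.at.continuousAt.tendsto
  rw [s2] at sd
  have hQΞ : SmoothNear (fun y => Q (Ξ y)) 0 := hQ.comp' s1 s2
  have hτΞ : SmoothNear (fun y => τ (Ξ y)) 0 := hτ.comp' s1 s2
  have hδΞ : SmoothNear (fun y => δ2 (Ξ y)) 0 := hδ2.comp' s1 s2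
  have hhΞ : SmoothNear (fun y => h (Ξ y)) 0 := hh.comp' s1 s2
  obtain ⟨A, B, hA, hB, hAB⟩ := whitney_local (fun y => Q (Ξ y)) hQΞ
  let R : ℝ × ℝ × ℝ → ℝ := fun y => fderiv ℝ (fun y => Q (Ξ y)) y (0, 0, 1)
  let S : ℝ × ℝ × ℝ → ℝ := fun y => fderiv ℝ (fun y => τ (Ξ y)) y (0, 0, 1)
  have hR : SmoothNear R 0 := by
    filter_upwards [hQΞ.fderiv] with y hy
    exact hy.clm_apply contDiffAt_const
  have hS : SmoothNear S 0 := by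
    filter_upwards [hτΞ.fderiv] with y hy
    exact hy.clm_apply contDiffAt_const
  have hRS : ∀ᶠ y in 𝓝 (0 : ℝ × ℝ × ℝ), R y * δ2 (Ξ y) = S y * h (Ξ y) := by
    filter_upwards [fderiv_comp_near hQ s1 s2, fderiv_comp_near hτ s1 s2, s5,
        sd.eventually H2] with y y1 y2 y5 y6
    have := y6 (fderiv ℝ Ξ y (0, 0, 1)) (y5 _).1 (y5 _).2.1
    simp only [R, S]
    rw [y1, y2]; exact this
  have hR0 : R 0 = 0 := by
    have := hRS.self_of_nhds
    rw [s2, hhp, mul_zero] at this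
    exact (mul_eq_zero.1 this).resolve_right hδ2p
  have hS0 : S 0 ≠ 0 := by
    have h1 := (fderiv_comp_near hτ s1 s2).self_of_nhds (0, 0, 1)
    have h2 := (s5.self_of_nhds (0, 0, 1)).2.2
    rw [s2, hxd] at h2
    simp only [S]
    rw [h1, s2]
    intro h3; rw [h3] at h2; simp at h2
  have hRd : fderiv ℝ R 0 (1, 0, 0) ≠ 0 := by
    have a1 := (hR.diff.hasFDerivAt.mul hδΞ.diff.hasFDerivAt)
    have a2 := (hS.diff.hasFDerivAt.mul hhΞ.diff.hasFDerivAt)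
    have a3 := a1.unique (a2.congr_of_eventuallyEq hRS)
    have a4 := DFunLike.congr_fun a3 (1, 0, 0)
    simp only [hR0, s2, hhp, zero_smul, zero_add,
      _root_.smul_apply, smul_eq_mul, add_zero] at a4
    have h1 := (fderiv_comp_near hh s1 s2).self_of_nhds (1, 0, 0)
    have h5 := (s5.self_of_nhds (1, 0, 0))
    rw [s2] at h5
    rw [h1, s2] at a4
    have h6 := H3 _ h5.1 h5.2.1 (by
      have := h5.2.2
      rw [hxd] at this
      exact (mul_eq_zero.1 this).resolve_left hκ)
    intro h7
    rw [h7] at a4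
    simp only [mul_zero] at a4
    exact (mul_ne_zero hS0 h6) a4.symm
  -- relation of R and B
  have hRB : ∀ᶠ y in 𝓝 (0 : ℝ × ℝ × ℝ), y.2.2 = 0 → R y = B y := by
    filter_upwards [eventually_eventually_nhds.2 hAB] with y hy hy0
    obtain ⟨y1, y2, y3⟩ := y
    simp only at hy0
    subst hy0
    have hQd : DifferentiableAt ℝ (fun y : ℝ × ℝ × ℝ => A (y.1, y.2.1, y.2.2 ^ 2) +
        y.2.2 * B (y.1, y.2.1, y.2.2 ^ 2)) (y1, y2, 0) := by
      have := hA.differentiable (by simp)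
      have := hB.differentiable (by simp)
      fun_prop
    have e1 : R (y1, y2, 0) = fderiv ℝ (fun y : ℝ × ℝ × ℝ => A (y.1, y.2.1, y.2.2 ^ 2) +
        y.2.2 * B (y.1, y.2.1, y.2.2 ^ 2)) (y1, y2, 0) (0, 0, 1) := by
      simp only [R]
      rw [Filter.EventuallyEq.fderiv_eq hy]
    rw [e1]
    have hl : HasDerivAt (fun θ : ℝ => (y1, y2, θ)) ((0 : ℝ), (0 : ℝ), (1 : ℝ)) 0 :=
      (hasDerivAt_const _ y1).prodMk ((hasDerivAt_const _ y2).prodMk (hasDerivAt_id 0))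
    have e2 := hQd.hasFDerivAt.comp_hasDerivAt (0 : ℝ) hl
    have e3 : HasDerivAt (fun θ : ℝ => A (y1, y2, θ ^ 2) + θ * B (y1, y2, θ ^ 2))
        (B (y1, y2, 0)) 0 := by
      have hl2 : HasDerivAt (fun θ : ℝ => (y1, y2, θ ^ 2)) ((0 : ℝ), (0 : ℝ), (0 : ℝ)) 0 := by
        have := hasDerivAt_pow 2 (0:ℝ)
        exact (hasDerivAt_const _ y1).prodMk ((hasDerivAt_const _ y2).prodMk
          (this.congr_deriv (by simp)))
      have f1 := ((hA.differentiable (by simp)) (y1, y2, 0 ^ 2)).hasFDerivAt.comp_hasDerivAt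
        (0 : ℝ) hl2
      have f2 := ((hB.differentiable (by simp)) (y1, y2, 0 ^ 2)).hasFDerivAt.comp_hasDerivAt
        (0 : ℝ) hl2
      have f3 := f1.add ((hasDerivAt_id (0 : ℝ)).mul f2)
      refine f3.congr_deriv ?_
      have : ((0 : ℝ), (0 : ℝ), (0 : ℝ)) = 0 := rfl
      simp [this]
    exact e2.unique e3
  have hB0 : B 0 = 0 := by rw [← hRB.self_of_nhds rfl, hR0]
  have hBd : fderiv ℝ B 0 (1, 0, 0) ≠ 0 := by
    have hl : HasDerivAt (fun θ : ℝ => (θ, (0 : ℝ), (0 : ℝ))) ((1 : ℝ), (0 : ℝ), (0 : ℝ)) 0 :=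
      (hasDerivAt_id 0).prodMk ((hasDerivAt_const _ 0).prodMk (hasDerivAt_const _ 0))
    have e1 : HasDerivAt (fun θ : ℝ => R (θ, (0 : ℝ), (0 : ℝ))) (fderiv ℝ R 0 (1, 0, 0)) 0 :=
      HasFDerivAt.comp_hasDerivAt (0 : ℝ) (f := fun θ : ℝ => (θ, (0 : ℝ), (0 : ℝ)))
        hR.diff.hasFDerivAt hl
    have e2 : HasDerivAt (fun θ : ℝ => B (θ, (0 : ℝ), (0 : ℝ))) (fderiv ℝ B 0 (1, 0, 0)) 0 :=
      HasFDerivAt.comp_hasDerivAt (0 : ℝ) (f := fun θ : ℝ => (θ, (0 : ℝ), (0 : ℝ)))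
        ((hB.differentiable (by simp)) 0).hasFDerivAt hl
    have e3 : (fun θ : ℝ => B (θ, (0 : ℝ), (0 : ℝ))) =ᶠ[𝓝 0] fun θ => R (θ, 0, 0) := by
      have hc : Tendsto (fun θ : ℝ => (θ, (0 : ℝ), (0 : ℝ))) (𝓝 0) (𝓝 0) := hl.continuousAt
      filter_upwards [hc.eventually hRB] with θ hθ
      exact (hθ rfl).symm
    rw [e2.unique (e1.congr_of_eventuallyEq e3)]
    exact hRd
  refine ⟨ε, c * ρ, fun y => P (Θ (y.1, y.2, 0)), A, B, x, hε, hκ, ?_, hA, hB, hx, hxp, hxd,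
    hB0, hBd, ?_, ?_⟩
  · have hi : SmoothNear (fun y : ℝ × ℝ => (y.1, y.2, (0 : ℝ))) 0 :=
      ContDiff.smoothNear (by fun_prop) 0
    exact hPΘ.comp' hi rfl
  · have hΨt : Tendsto (fun q => (u q, v q, w q)) (𝓝 p) (𝓝 0) := by
      have := hΨ.at.continuousAt.tendsto
      rwa [hΨ0] at this
    have hpos : ∀ᶠ q in 𝓝 p, 0 < ε * m (u q, v q, w q) := by
      have hc : ContinuousAt (fun q => ε * m (u q, v q, w q)) p :=
        hmΨ.at.continuousAt.const_mul ε
      refine hc.eventually (lt_mem_nhds ?_)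
      change 0 < ε * m (u p, v p, w p)
      rw [hΨ0]; exact hεm
    filter_upwards [hΨt.eventually hPm, t3, hpos] with q h1 h2 h3
    simp only [h2] at h1
    rw [h1]
    simp only [x, mul_pow]
    rw [Real.sq_sqrt h3.le]
    linear_combination (- w q ^ 2 * m (u q, v q, w q)) * hε
  · have hΨt : Tendsto (fun q => (u q, v q, x q)) (𝓝 p) (𝓝 0) := by
      have := (hu.prodMk (hv.prodMk hx)).at.continuousAt.tendsto
      simp only [hup, hvp, hxp] at this
      exact this
    filter_upwards [hΨt.eventually hAB, s3] with q h1 h2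
    simp only [h2] at h1
    exact h1

theorem isDiffeoGermAt_of_inj {E : Type*} [NormedAddCommGroup E] [NormedSpace ℝ E]
    [FiniteDimensional ℝ E] {φ : E → E} {p : E} (h : ContDiffAt ℝ ∞ φ p)
    (hinj : ∀ k, fderiv ℝ φ p k = 0 → k = 0) : IsDiffeoGermAt φ p := by
  refine ⟨h, ?_⟩
  have hi : Function.Injective (fderiv ℝ φ p : E →ₗ[ℝ] E) := by
    rw [injective_iff_map_eq_zero]; exact hinj
  exact ⟨hi, LinearMap.injective_iff_surjective.1 hi⟩

theorem finish {F : ℝ × ℝ × ℝ → E4} {p : ℝ × ℝ × ℝ} {U V L M : E4 →L[ℝ] ℝ}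
    (hUV : ∀ y, U y = 0 → V y = 0 → L y = 0 → M y = 0 → y = 0)
    {u v P Q x τ : ℝ × ℝ × ℝ → ℝ}
    (hu : SmoothNear u p) (hv : SmoothNear v p)
    (eu : ∀ q, u q = U (F q - F p)) (ev : ∀ q, v q = V (F q - F p))
    (eP : ∀ q, P q = L (F q - F p)) (eQ : ∀ q, Q q = M (F q - F p))
    (hinj : ∀ k, fderiv ℝ u p k = 0 → fderiv ℝ v p k = 0 → fderiv ℝ τ p k = 0 → k = 0)
    {ε κ : ℝ} {p0 : ℝ × ℝ → ℝ} {A B : ℝ × ℝ × ℝ → ℝ}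
    (hε : ε * ε = 1) (hκ : κ ≠ 0) (hp0 : SmoothNear p0 0) (hA : ContDiff ℝ ∞ A)
    (hB : ContDiff ℝ ∞ B) (hx : SmoothNear x p) (hxp : x p = 0)
    (hxd : ∀ k, fderiv ℝ x p k = κ * fderiv ℝ τ p k) (hB0 : B 0 = 0)
    (hBd : fderiv ℝ B 0 (1, 0, 0) ≠ 0)
    (hP : ∀ᶠ q in 𝓝 p, P q = p0 (u q, v q) + ε * x q ^ 2)
    (hQ : ∀ᶠ q in 𝓝 p, Q q = A (u q, v q, x q ^ 2) + x q * B (u q, v q, x q ^ 2)) :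
    AEquivAt F p (fun q => ![q.1, q.2.1, q.2.2^2, q.1 * q.2.2]) := by
  have hup : u p = 0 := by simp [eu]
  have hvp : v p = 0 := by simp [ev]
  have hPp : P p = 0 := by simp [eP]
  have hQp : Q p = 0 := by simp [eQ]
  have hp00 : p0 0 = 0 := by
    have := hP.self_of_nhds
    rw [hup, hvp, hxp, hPp] at this
    simp at this; exact this.symm
  have hA00 : A 0 = 0 := by
    have := hQ.self_of_nhds
    rw [hup, hvp, hxp, hQp] at this
    simp at this; exact this.symm
  have hBlin : ∀ e : ℝ, fderiv ℝ B 0 (e, 0, 0) = 0 → e = 0 := by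
    intro e he
    have : ((e, 0, 0) : ℝ × ℝ × ℝ) = e • ((1, 0, 0) : ℝ × ℝ × ℝ) := by simp
    rw [this, map_smul, smul_eq_mul] at he
    exact (mul_eq_zero.1 he).resolve_right hBd
  have hz3 : ((0 : ℝ), (0 : ℝ), (0 : ℝ)) = 0 := rfl
  have hz2 : ((0 : ℝ), (0 : ℝ)) = 0 := rfl
  -- source
  have hx2 : SmoothNear (fun q => x q ^ 2) p := by
    simpa only [pow_two] using hx.mul hx
  have hx2d : ∀ k, fderiv ℝ (fun q => x q ^ 2) p k = 0 := by
    intro k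
    have := (hx.diff.hasFDerivAt.pow 2).fderiv
    have h2 : fderiv ℝ (fun q => x q ^ 2) p = _ := this
    rw [h2, hxp]; simp
  have hW : SmoothNear (fun q => (u q, v q, x q ^ 2)) p := hu.prodMk (hv.prodMk hx2)
  have hWp : (u p, v p, x p ^ 2) = 0 := by rw [hup, hvp, hxp]; simp
  have hBW : SmoothNear (fun q => B (u q, v q, x q ^ 2)) p := (hB.smoothNear _).comp hW
  -- target
  let N : E4 → ℝ := fun y => ε * (L (y - F p) - p0 (U (y - F p), V (y - F p)))
  have hc : ∀ T : E4 →L[ℝ] ℝ, SmoothNear (fun y => T (y - F p)) (F p) := by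
    intro T
    exact ContDiff.smoothNear (T.contDiff.comp (contDiff_id.sub contDiff_const)) _
  have hcd : ∀ (T : E4 →L[ℝ] ℝ), HasFDerivAt (fun y => T (y - F p)) T (F p) := by
    intro T
    exact T.hasFDerivAt.comp (F p) ((hasFDerivAt_id (F p)).sub_const (F p))
  have hUVs : SmoothNear (fun y => (U (y - F p), V (y - F p))) (F p) := (hc U).prodMk (hc V)
  have hp0s : SmoothNear (fun y => p0 (U (y - F p), V (y - F p))) (F p) :=
    hp0.comp' hUVs (by simp)
  have hN : SmoothNear N (F p) :=
    (contDiff_const.smoothNear (F p)).mul ((hc L).sub hp0s)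
  have hNp : N (F p) = 0 := by
    simp only [N, sub_self, map_zero]; rw [hz2, hp00]; simp
  have hNd : HasFDerivAt N (ε • (L - (fderiv ℝ p0 0).comp (U.prod V))) (F p) := by
    have h1 : HasFDerivAt p0 (fderiv ℝ p0 0) (U (F p - F p), V (F p - F p)) := by
      simp only [sub_self, map_zero]; exact hp0.diff.hasFDerivAt
    exact ((hcd L).sub (h1.comp (F p) ((hcd U).prodMk (hcd V)))).const_mul ε
  have hT : SmoothNear (fun y => (U (y - F p), V (y - F p), N y)) (F p) :=
    (hc U).prodMk ((hc V).prodMk hN)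
  have hTd := ((hcd U).prodMk ((hcd V).prodMk hNd))
  have hcomp : ∀ D : ℝ × ℝ × ℝ → ℝ, ContDiff ℝ ∞ D →
      SmoothNear (fun y => D (U (y - F p), V (y - F p), N y)) (F p) ∧
      HasFDerivAt (fun y => D (U (y - F p), V (y - F p), N y))
        ((fderiv ℝ D 0).comp (U.prod (V.prod (ε • (L - (fderiv ℝ p0 0).comp (U.prod V)))))) (F p) := by
    intro D hD
    refine ⟨(hD.smoothNear _).comp hT, ?_⟩
    have h1 : HasFDerivAt D (fderiv ℝ D 0) (U (F p - F p), V (F p - F p), N (F p)) := by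
      simp only [sub_self, map_zero, hNp]
      exact (hD.differentiable (by simp) 0).hasFDerivAt
    exact h1.comp (F p) hTd
  refine ⟨fun q => (B (u q, v q, x q ^ 2), v q, x q),
    fun y => ![B (U (y - F p), V (y - F p), N y), V (y - F p), N y,
      M (y - F p) - A (U (y - F p), V (y - F p), N y)], ?_, ?_, ?_, ?_, ?_⟩
  · apply isDiffeoGermAt_of_inj (hBW.prodMk (hv.prodMk hx)).at
    intro k hk
    rw [fderiv_triple hBW.diff hv.diff hx.diff] at hk
    simp only [Prod.mk_eq_zero] at hk
    obtain ⟨k1, k2, k3⟩ := hk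
    rw [hxd] at k3
    have k3' := (mul_eq_zero.1 k3).resolve_left hκ
    refine hinj k (hBlin _ ?_) k2 k3'
    have := (fderiv_comp_near (hB.smoothNear _) hW rfl).self_of_nhds k
    rw [this, hWp, fderiv_triple hu.diff hv.diff hx2.diff, k2, hx2d] at k1
    exact k1
  · have hsm : ContDiffAt ℝ ∞ (fun y => ![B (U (y - F p), V (y - F p), N y), V (y - F p), N y,
      M (y - F p) - A (U (y - F p), V (y - F p), N y)]) (F p) := by
      rw [contDiffAt_pi]
      intro i
      fin_cases i
      · exact (hcomp B hB).1.at
      · exact (hc V).at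
      · exact hN.at
      · exact ((hc M).sub (hcomp A hA).1).at
    apply isDiffeoGermAt_of_inj hsm
    intro k hk
    have hd := (hsm.differentiableAt (by simp)).hasFDerivAt
    rw [hasFDerivAt_pi'] at hd
    have hi : ∀ i : Fin 4, (ContinuousLinearMap.proj (R := ℝ) (φ := fun _ : Fin 4 => ℝ) i).comp
      (fderiv ℝ (fun y => ![B (U (y - F p), V (y - F p), N y), V (y - F p), N y,
      M (y - F p) - A (U (y - F p), V (y - F p), N y)]) (F p)) k = 0 := by
      intro i
      simp only [ContinuousLinearMap.comp_apply, hk, map_zero]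
    have d0 := (hd 0).unique (hcomp B hB).2
    have d1 := (hd 1).unique (hcd V)
    have d2 := (hd 2).unique hNd
    have d3 := (hd 3).unique ((hcd M).sub (hcomp A hA).2)
    have i0 := hi 0
    have i1 := hi 1
    have i2 := hi 2
    have i3 := hi 3
    rw [d0] at i0
    rw [d1] at i1
    rw [d2] at i2
    rw [d3] at i3
    have i2' : ε * (L k - fderiv ℝ p0 0 (U k, V k)) = 0 := i2
    have i0' : fderiv ℝ B 0 (U k, V k, ε * (L k - fderiv ℝ p0 0 (U k, V k))) = 0 := i0
    have i3' : M k - fderiv ℝ A 0 (U k, V k, ε * (L k - fderiv ℝ p0 0 (U k, V k))) = 0 := i3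
    rw [i2', i1] at i0'
    have hU := hBlin _ i0'
    rw [i2', i1, hU, hz3, map_zero, sub_zero] at i3'
    rw [i1, hU, hz2, map_zero, sub_zero] at i2'
    have hε0 : ε ≠ 0 := by rintro rfl; simp at hε
    exact hUV k hU i1 ((mul_eq_zero.1 i2').resolve_left hε0) i3'
  · change (B (u p, v p, x p ^ 2), v p, x p) = 0
    rw [hWp, hB0, hvp, hxp]; rfl
  · simp only [sub_self, map_zero, hNp]
    rw [hz3, hB0, hA00]
    ext i; fin_cases i <;> simp
  · filter_upwards [hP, hQ] with q h1 h2
    have hNq : N (F q) = x q ^ 2 := by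
      simp only [N]
      rw [← eu, ← ev, ← eP, h1]
      linear_combination (x q ^ 2) * hε
    simp only [hNq]
    rw [← eu, ← ev, ← eQ, h2]
    ext i; fin_cases i <;> simp
    ring

theorem dot4_eq (u v : E4) : dot4 u v = u 0 * v 0 + u 1 * v 1 + u 2 * v 2 + u 3 * v 3 := by
  simp [dot4, Fin.sum_univ_succ]; ring

theorem det4_eq (u v w x : E4) : det4 u v w x =
    u 0 * (v 1 * (w 2 * x 3 - w 3 * x 2) - v 2 * (w 1 * x 3 - w 3 * x 1)
      + v 3 * (w 1 * x 2 - w 2 * x 1))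
    - u 1 * (v 0 * (w 2 * x 3 - w 3 * x 2) - v 2 * (w 0 * x 3 - w 3 * x 0)
      + v 3 * (w 0 * x 2 - w 2 * x 0))
    + u 2 * (v 0 * (w 1 * x 3 - w 3 * x 1) - v 1 * (w 0 * x 3 - w 3 * x 0)
      + v 3 * (w 0 * x 1 - w 1 * x 0))
    - u 3 * (v 0 * (w 1 * x 2 - w 2 * x 1) - v 1 * (w 0 * x 2 - w 2 * x 0)
      + v 2 * (w 0 * x 1 - w 1 * x 0)) := by
  simp [det4, Matrix.det_succ_row_zero, Fin.sum_univ_succ, Fin.succAbove]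
  ring

theorem det4_dot (u v w x : E4) : det4 u v w x = dot4 u (tcross v w x) := by
  simp only [dot4_eq, tcross, det4_eq]
  simp
  ring

theorem tcross_gram (a b c : E4) : dot4 (tcross a b c) (tcross a b c) =
    dot4 a a * (dot4 b b * dot4 c c - dot4 b c * dot4 b c)
    - dot4 a b * (dot4 a b * dot4 c c - dot4 b c * dot4 a c)
    + dot4 a c * (dot4 a b * dot4 b c - dot4 b b * dot4 a c) := by
  simp only [dot4_eq, tcross, det4_eq]
  simp
  ring

/-- inner product as a functional -/
def dotL (v : E4) : E4 →L[ℝ] ℝ :=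
  ∑ i, v i • (ContinuousLinearMap.proj (R := ℝ) (φ := fun _ : Fin 4 => ℝ) i)

theorem dotL_apply (v y : E4) : dotL v y = dot4 y v := by
  simp [dotL, dot4, mul_comm]

theorem dot4_add (u v w : E4) : dot4 (u + v) w = dot4 u w + dot4 v w := by
  simp only [← dotL_apply, map_add]
theorem dot4_smul (c : ℝ) (u w : E4) : dot4 (c • u) w = c * dot4 u w := by
  simp only [← dotL_apply, map_smul, smul_eq_mul]
theorem dot4_sub (u v w : E4) : dot4 (u - v) w = dot4 u w - dot4 v w := by
  simp only [← dotL_apply, map_sub]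
theorem dot4_comm (u v : E4) : dot4 u v = dot4 v u := by
  simp only [dot4_eq]; ring

theorem det4_alt1 (u v w : E4) : det4 u u v w = 0 := by simp only [det4_eq]; ring
theorem det4_alt2 (u v w : E4) : det4 u v u w = 0 := by simp only [det4_eq]; ring
theorem det4_alt3 (u v w : E4) : det4 u v w u = 0 := by simp only [det4_eq]; ring
theorem det4_swap (u v w x : E4) : det4 x v w u = - det4 u v w x := by simp only [det4_eq]; ring
theorem det4_add (u u' v w x : E4) : det4 (u + u') v w x = det4 u v w x + det4 u' v w x := by
  simp only [det4_dot, dot4_add]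
theorem det4_smul (c : ℝ) (u v w x : E4) : det4 (c • u) v w x = c * det4 u v w x := by
  simp only [det4_dot, dot4_smul]

theorem contDiff_det4 {f g h k : ℝ → E4} (hf : ContDiff ℝ ∞ f) (hg : ContDiff ℝ ∞ g)
    (hh : ContDiff ℝ ∞ h) (hk : ContDiff ℝ ∞ k) :
    ContDiff ℝ ∞ fun t => det4 (f t) (g t) (h t) (k t) := by
  rw [contDiff_pi] at hf hg hh hk
  simp only [det4_eq]
  have f0 := hf 0; have f1 := hf 1; have f2 := hf 2; have f3 := hf 3
  have g0 := hg 0; have g1 := hg 1; have g2 := hg 2; have g3 := hg 3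
  have h0 := hh 0; have h1 := hh 1; have h2 := hh 2; have h3 := hh 3
  have k0 := hk 0; have k1 := hk 1; have k2 := hk 2; have k3 := hk 3
  fun_prop

theorem contDiff_tcross {g h k : ℝ → E4} (hg : ContDiff ℝ ∞ g)
    (hh : ContDiff ℝ ∞ h) (hk : ContDiff ℝ ∞ k) :
    ContDiff ℝ ∞ fun t => tcross (g t) (h t) (k t) := by
  rw [contDiff_pi]
  intro i
  exact contDiff_det4 contDiff_const hg hh hk

/-- an orthonormal triple -/
structure Frame (a b c : E4) : Prop where
  aa : dot4 a a = 1
  bb : dot4 b b = 1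
  cc : dot4 c c = 1
  ab : dot4 a b = 0
  ac : dot4 a c = 0
  bc : dot4 b c = 0

theorem Frame.zz {a b c : E4} (h : Frame a b c) :
    dot4 (tcross a b c) (tcross a b c) = 1 := by
  rw [tcross_gram, h.aa, h.bb, h.cc, h.ab, h.ac, h.bc]; norm_num

theorem Frame.az {a b c : E4} : dot4 a (tcross a b c) = 0 := by rw [← det4_dot, det4_alt1]
theorem Frame.bz {a b c : E4} : dot4 b (tcross a b c) = 0 := by rw [← det4_dot, det4_alt2]
theorem Frame.cz {a b c : E4} : dot4 c (tcross a b c) = 0 := by rw [← det4_dot, det4_alt3]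

theorem Frame.eq_zero {a b c : E4} (h : Frame a b c) {y : E4} (ha : dot4 y a = 0)
    (hb : dot4 y b = 0) (hc : dot4 y c = 0) (hz : dot4 y (tcross a b c) = 0) : y = 0 := by
  have hdet : Matrix.det (Matrix.of ![tcross a b c, a, b, c]) ≠ 0 := by
    have : Matrix.det (Matrix.of ![tcross a b c, a, b, c]) = det4 (tcross a b c) a b c := rfl
    rw [this, det4_dot, h.zz]; norm_num
  apply Matrix.eq_zero_of_mulVec_eq_zero hdet
  rw [dot4_comm] at ha hb hc hz
  ext i
  fin_cases i
  · exact hz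
  · exact ha
  · exact hb
  · exact hc

theorem Frame.expand {a b c : E4} (h : Frame a b c) (y : E4) (ha : dot4 y a = 0)
    (hb : dot4 y b = 0) :
    y = dot4 y (tcross a b c) • tcross a b c + dot4 y c • c := by
  rw [← sub_eq_zero]
  have hza : dot4 (tcross a b c) a = 0 := by rw [dot4_comm, Frame.az]
  have hzb : dot4 (tcross a b c) b = 0 := by rw [dot4_comm, Frame.bz]
  have hzc : dot4 (tcross a b c) c = 0 := by rw [dot4_comm, Frame.cz]
  have hca : dot4 c a = 0 := by rw [dot4_comm, h.ac]
  have hcb : dot4 c b = 0 := by rw [dot4_comm, h.bc]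
  apply h.eq_zero <;> simp only [dot4_sub, dot4_add, dot4_smul, ha, hb, hza, hzb, hzc, hca, hcb,
    h.zz, h.cc, Frame.cz] <;> ring

theorem deriv_dot4 {f g : ℝ → E4} {t : ℝ} (hf : DifferentiableAt ℝ f t)
    (hg : DifferentiableAt ℝ g t) :
    HasDerivAt (fun t => dot4 (f t) (g t)) (dot4 (deriv f t) (g t) + dot4 (f t) (deriv g t)) t := by
  have hf' := hasDerivAt_pi.1 hf.hasDerivAt
  have hg' := hasDerivAt_pi.1 hg.hasDerivAt
  have := ((hf' 0).mul (hg' 0)).add (((hf' 1).mul (hg' 1)).add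
    (((hf' 2).mul (hg' 2)).add ((hf' 3).mul (hg' 3))))
  have h2 := this.congr_of_eventuallyEq (f₁ := fun t => dot4 (f t) (g t))
    (Eventually.of_forall fun t => by simp [dot4_eq]; ring)
  refine h2.congr_deriv ?_
  simp [dot4_eq]; ring

theorem frame_zero {X Y : ℝ → E4} (hX : ContDiff ℝ ∞ X) (hY : ContDiff ℝ ∞ Y)
    (hXunit : ∀ᶠ t in 𝓝 (0:ℝ), dot4 (X t) (X t) = 1)
    (hYunit : ∀ᶠ t in 𝓝 (0:ℝ), dot4 (Y t) (Y t) = 1)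
    (hXY : ∀ᶠ t in 𝓝 (0:ℝ), dot4 (X t) (Y t) = 0)
    (hXY' : ∀ᶠ t in 𝓝 (0:ℝ), dot4 (X t) (deriv Y t) = 0)
    (hX'unit : ∀ᶠ t in 𝓝 (0:ℝ), dot4 (deriv X t) (deriv X t) = 1) :
    Frame (X 0) (Y 0) (deriv X 0) := by
  have dX := hX.differentiable (by simp) 0
  have dY := hY.differentiable (by simp) 0
  refine ⟨hXunit.self_of_nhds, hYunit.self_of_nhds, hX'unit.self_of_nhds,
    hXY.self_of_nhds, ?_, ?_⟩
  · have h1 := deriv_dot4 dX dX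
    have h2 := h1.unique ((hasDerivAt_const (0:ℝ) (1:ℝ)).congr_of_eventuallyEq hXunit)
    rw [dot4_comm (deriv X 0)] at h2
    linarith
  · have h1 := deriv_dot4 dX dY
    have h2 := h1.unique ((hasDerivAt_const (0:ℝ) (0:ℝ)).congr_of_eventuallyEq hXY)
    rw [hXY'.self_of_nhds, dot4_comm] at h2
    linarith

theorem fderiv_F {γ X Y : ℝ → E4} (hγ : ContDiff ℝ ∞ γ) (hX : ContDiff ℝ ∞ X)
    (hY : ContDiff ℝ ∞ Y) (q k : ℝ × ℝ × ℝ) :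
    fderiv ℝ (fun p : ℝ × ℝ × ℝ => γ p.1 + p.2.1 • X p.1 + p.2.2 • Y p.1) q k =
      k.1 • (deriv γ q.1 + q.2.1 • deriv X q.1 + q.2.2 • deriv Y q.1) + k.2.1 • X q.1
        + k.2.2 • Y q.1 := by
  have hc : ∀ f : ℝ → E4, ContDiff ℝ ∞ f → HasFDerivAt (fun p : ℝ × ℝ × ℝ => f p.1)
      ((ContinuousLinearMap.toSpanSingleton ℝ (deriv f q.1)).comp
        (ContinuousLinearMap.fst ℝ ℝ (ℝ × ℝ))) q := fun f hf =>
    ((hf.differentiable (by simp) q.1).hasDerivAt.hasFDerivAt).comp q hasFDerivAt_fst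
  have h1 : HasFDerivAt (fun p : ℝ × ℝ × ℝ => p.2.1)
    ((ContinuousLinearMap.fst ℝ ℝ ℝ).comp (ContinuousLinearMap.snd ℝ ℝ (ℝ × ℝ))) q :=
    ((ContinuousLinearMap.fst ℝ ℝ ℝ).comp (ContinuousLinearMap.snd ℝ ℝ (ℝ × ℝ))).hasFDerivAt
  have h2 : HasFDerivAt (fun p : ℝ × ℝ × ℝ => p.2.2)
    ((ContinuousLinearMap.snd ℝ ℝ ℝ).comp (ContinuousLinearMap.snd ℝ ℝ (ℝ × ℝ))) q :=
    ((ContinuousLinearMap.snd ℝ ℝ ℝ).comp (ContinuousLinearMap.snd ℝ ℝ (ℝ × ℝ))).hasFDerivAt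
  have := (((hc γ hγ).add (h1.smul (hc X hX))).add (h2.smul (hc Y hY))).fderiv
  have h3 : fderiv ℝ (fun p : ℝ × ℝ × ℝ => γ p.1 + p.2.1 • X p.1 + p.2.2 • Y p.1) q = _ := this
  rw [h3]
  simp [smul_smul]
  ext i
  simp
  ring

/-- derivative at a common zero -/
theorem fderiv_two {σ : ℝ × ℝ × ℝ → ℝ} {α β η : ℝ → ℝ} {p : ℝ × ℝ × ℝ}
    (hσ : ContDiff ℝ ∞ σ) (hα : ContDiff ℝ ∞ α) (hβ : ContDiff ℝ ∞ β) (hη : ContDiff ℝ ∞ η)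
    (h0 : σ p = 0) (h1 : β p.1 = 0) (k : ℝ × ℝ × ℝ) :
    fderiv ℝ (fun q : ℝ × ℝ × ℝ => σ q * α q.1 + β q.1 * η q.1) p k =
      fderiv ℝ σ p k * α p.1 + k.1 * deriv β p.1 * η p.1 := by
  have hc : ∀ f : ℝ → ℝ, ContDiff ℝ ∞ f → HasFDerivAt (fun p : ℝ × ℝ × ℝ => f p.1)
      ((ContinuousLinearMap.toSpanSingleton ℝ (deriv f p.1)).comp
        (ContinuousLinearMap.fst ℝ ℝ (ℝ × ℝ))) p := fun f hf =>
    ((hf.differentiable (by simp) p.1).hasDerivAt.hasFDerivAt).comp p hasFDerivAt_fst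
  have := ((((hσ.differentiable (by simp)) p).hasFDerivAt.mul (hc α hα)).add
    ((hc β hβ).mul (hc η hη))).fderiv
  have h3 : fderiv ℝ (fun q : ℝ × ℝ × ℝ => σ q * α q.1 + β q.1 * η q.1) p = _ := this
  rw [h3, h0, h1]
  simp
  ring

theorem fderiv_sigma {a b₃ : ℝ → ℝ} (ha : ContDiff ℝ ∞ a) (hb₃ : ContDiff ℝ ∞ b₃)
    (p k : ℝ × ℝ × ℝ) :
    fderiv ℝ (fun q : ℝ × ℝ × ℝ => b₃ q.1 + q.2.1 + q.2.2 * a q.1) p k =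
      k.1 * (deriv b₃ p.1 + p.2.2 * deriv a p.1) + k.2.1 + k.2.2 * a p.1 := by
  have hc : ∀ f : ℝ → ℝ, ContDiff ℝ ∞ f → HasFDerivAt (fun p : ℝ × ℝ × ℝ => f p.1)
      ((ContinuousLinearMap.toSpanSingleton ℝ (deriv f p.1)).comp
        (ContinuousLinearMap.fst ℝ ℝ (ℝ × ℝ))) p := fun f hf =>
    ((hf.differentiable (by simp) p.1).hasDerivAt.hasFDerivAt).comp p hasFDerivAt_fst
  have h1 : HasFDerivAt (fun p : ℝ × ℝ × ℝ => p.2.1)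
    ((ContinuousLinearMap.fst ℝ ℝ ℝ).comp (ContinuousLinearMap.snd ℝ ℝ (ℝ × ℝ))) p :=
    ((ContinuousLinearMap.fst ℝ ℝ ℝ).comp (ContinuousLinearMap.snd ℝ ℝ (ℝ × ℝ))).hasFDerivAt
  have h2 : HasFDerivAt (fun p : ℝ × ℝ × ℝ => p.2.2)
    ((ContinuousLinearMap.snd ℝ ℝ ℝ).comp (ContinuousLinearMap.snd ℝ ℝ (ℝ × ℝ))) p :=
    ((ContinuousLinearMap.snd ℝ ℝ ℝ).comp (ContinuousLinearMap.snd ℝ ℝ (ℝ × ℝ))).hasFDerivAt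
  have := (((hc b₃ hb₃).add h1).add (h2.mul (hc a ha))).fderiv
  have h3 : fderiv ℝ (fun q : ℝ × ℝ × ℝ => b₃ q.1 + q.2.1 + q.2.2 * a q.1) p = _ := this
  rw [h3]
  simp
  ring

theorem sufficiency {X Y : ℝ → E4} {a b₁ b₂ b₃ b₄ : ℝ → ℝ}
    (hX : ContDiff ℝ ∞ X) (hY : ContDiff ℝ ∞ Y)
    (ha : ContDiff ℝ ∞ a) (hb₃ : ContDiff ℝ ∞ b₃) (hb₄ : ContDiff ℝ ∞ b₄)
    (hfr : Frame (X 0) (Y 0) (deriv X 0))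
    {F : ℝ × ℝ × ℝ → E4} (hFs : ContDiff ℝ ∞ F)
    {s r : ℝ}
    (hFd : ∀ᶠ q in 𝓝 ((0, s, r) : ℝ × ℝ × ℝ), ∀ k, fderiv ℝ F q k =
      k.1 • (b₁ q.1 • X q.1 + b₂ q.1 • Y q.1 + (b₃ q.1 + q.2.1 + q.2.2 * a q.1) • deriv X q.1 +
        b₄ q.1 • tcross (X q.1) (Y q.1) (deriv X q.1)) + k.2.1 • X q.1 + k.2.2 • Y q.1)
    (hsing₁ : b₄ 0 = 0) (hsing₂ : b₃ 0 + s + r * a 0 = 0) (hne : deriv b₄ 0 ≠ 0) :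
    AEquivAt F (0, s, r) (fun q => ![q.1, q.2.1, q.2.2^2, q.1 * q.2.2]) := by
  set p : ℝ × ℝ × ℝ := (0, s, r) with hp
  set X0 := X 0
  set Y0 := Y 0
  set V0 := deriv X 0
  set Z0 := tcross X0 Y0 V0
  have hX' : ContDiff ℝ ∞ (deriv X) := by
    have := hX.iterate_deriv 1
    exact this
  have hZ : ContDiff ℝ ∞ fun t => tcross (X t) (Y t) (deriv X t) := contDiff_tcross hX hY hX'
  have hl : ∀ T : E4 →L[ℝ] ℝ, SmoothNear (fun q => T (F q - F p)) p := fun T =>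
    ContDiff.smoothNear (T.contDiff.comp (hFs.sub contDiff_const)) _
  have hld : ∀ (T : E4 →L[ℝ] ℝ) (q k : ℝ × ℝ × ℝ),
      fderiv ℝ (fun q => T (F q - F p)) q k = T (fderiv ℝ F q k) := by
    intro T q k
    have := (T.hasFDerivAt.comp q (((hFs.differentiable (by simp)) q).hasFDerivAt.sub_const
      (F p))).fderiv
    have h2 : fderiv ℝ (fun q => T (F q - F p)) q = _ := this
    rw [h2]; rfl
  have hfst : ∀ q k : ℝ × ℝ × ℝ, fderiv ℝ (fun q : ℝ × ℝ × ℝ => q.1) q k = k.1 := by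
    intro q k
    have : fderiv ℝ (fun q : ℝ × ℝ × ℝ => q.1) q = _ := hasFDerivAt_fst.fderiv
    rw [this]; rfl
  have hσs : ContDiff ℝ ∞ (fun q : ℝ × ℝ × ℝ => b₃ q.1 + q.2.1 + q.2.2 * a q.1) := by fun_prop
  have hσp : (fun q : ℝ × ℝ × ℝ => b₃ q.1 + q.2.1 + q.2.2 * a q.1) p = 0 := hsing₂
  have hc0 : ∀ v : E4, ContDiff ℝ ∞ (fun _ : ℝ => v) := fun v => contDiff_const
  have hα1 := contDiff_det4 hX' hX hY (hc0 V0)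
  have hα2 := contDiff_det4 hX' hX hY (hc0 Z0)
  have hη1 := contDiff_det4 hZ hX hY (hc0 V0)
  have hη2 := contDiff_det4 hZ hX hY (hc0 Z0)
  have hδ1 := contDiff_det4 (hc0 Z0) hX hY (hc0 V0)
  have hδ2 := contDiff_det4 (hc0 V0) hX hY (hc0 Z0)
  have hZ1 : det4 Z0 X0 Y0 V0 = 1 := by rw [det4_dot]; exact hfr.zz
  have hZ2 : det4 V0 X0 Y0 Z0 = -1 := by rw [det4_swap, hZ1]
  have hws := ((hσs.mul (hα1.comp contDiff_fst)).add
    ((hb₄.mul hη1).comp contDiff_fst)).smoothNear p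
  have hhs := ((hσs.mul (hα2.comp contDiff_fst)).add
    ((hb₄.mul hη2).comp contDiff_fst)).smoothNear p
  have hYX : dot4 Y0 X0 = 0 := by rw [dot4_comm]; exact hfr.ab
  have hVX : dot4 V0 X0 = 0 := by rw [dot4_comm]; exact hfr.ac
  have hVY : dot4 V0 Y0 = 0 := by rw [dot4_comm]; exact hfr.bc
  have hdu : ∀ k : ℝ × ℝ × ℝ, dot4 (fderiv ℝ F p k) X0 = k.1 * b₁ 0 + k.2.1 := by
    intro k
    rw [hFd.self_of_nhds k]
    have e1 : b₃ p.1 + p.2.1 + p.2.2 * a p.1 = 0 := hsing₂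
    have e2 : b₄ p.1 = 0 := hsing₁
    rw [e1, e2]
    simp only [dot4_add, dot4_smul, zero_smul, add_zero, hp]
    change k.1 * (b₁ 0 * dot4 X0 X0 + b₂ 0 * dot4 Y0 X0) + k.2.1 * dot4 X0 X0
      + k.2.2 * dot4 Y0 X0 = _
    rw [hfr.aa, hYX]; ring
  have hdv : ∀ k : ℝ × ℝ × ℝ, dot4 (fderiv ℝ F p k) Y0 = k.1 * b₂ 0 + k.2.2 := by
    intro k
    rw [hFd.self_of_nhds k]
    have e1 : b₃ p.1 + p.2.1 + p.2.2 * a p.1 = 0 := hsing₂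
    have e2 : b₄ p.1 = 0 := hsing₁
    rw [e1, e2]
    simp only [dot4_add, dot4_smul, zero_smul, add_zero, hp]
    change k.1 * (b₁ 0 * dot4 X0 Y0 + b₂ 0 * dot4 Y0 Y0) + k.2.1 * dot4 X0 Y0
      + k.2.2 * dot4 Y0 Y0 = _
    rw [hfr.bb, hfr.ab]; ring
  have hinj : ∀ k, fderiv ℝ (fun q => dotL X0 (F q - F p)) p k = 0 →
      fderiv ℝ (fun q => dotL Y0 (F q - F p)) p k = 0 →
      fderiv ℝ (fun q : ℝ × ℝ × ℝ => q.1) p k = 0 → k = 0 := by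
    intro k h1 h2 h3
    rw [hld, dotL_apply, hdu] at h1
    rw [hld, dotL_apply, hdv] at h2
    rw [hfst] at h3
    rw [h3] at h1 h2
    ext
    · exact h3
    · simpa using h1
    · simpa using h2
  -- the determinant identities
  have hdet : ∀ᶠ q in 𝓝 p, ∀ (k : ℝ × ℝ × ℝ) (W : E4),
      det4 (fderiv ℝ F q k) (X q.1) (Y q.1) W =
      k.1 * ((b₃ q.1 + q.2.1 + q.2.2 * a q.1) * det4 (deriv X q.1) (X q.1) (Y q.1) W
        + b₄ q.1 * det4 (tcross (X q.1) (Y q.1) (deriv X q.1)) (X q.1) (Y q.1) W) := by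
    filter_upwards [hFd] with q hq k W
    rw [hq]
    simp only [det4_add, det4_smul, det4_alt1, det4_alt2]
    ring
  obtain ⟨ε, κ, p0, A, B, x, h1, h2, h3, h4, h5, h6, h7, h8, h9, h10, h11, h12⟩ :=
    core (p := p) (c := deriv b₄ 0) (hl (dotL X0)) (hl (dotL Y0)) (hl (dotL Z0)) (hl (dotL V0))
      hws ((hδ1.comp contDiff_fst).smoothNear p)
      ((hδ2.comp contDiff_fst).smoothNear p) hhs
      (τ := fun q : ℝ × ℝ × ℝ => q.1) (contDiff_fst.smoothNear p) (by simp) (by simp)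
      (by
        change (b₃ 0 + s + r * a 0) * _ + b₄ 0 * _ = 0
        rw [hsing₁, hsing₂]; simp)
      (by change det4 Z0 X0 Y0 V0 ≠ 0; rw [hZ1]; norm_num)
      (by change det4 V0 X0 Y0 Z0 ≠ 0; rw [hZ2]; norm_num)
      (by
        change (b₃ 0 + s + r * a 0) * _ + b₄ 0 * _ = 0
        rw [hsing₁, hsing₂]; simp)
      hne
      (by
        intro k
        refine (fderiv_two hσs hα1 hb₄ hη1 hσp hsing₁ k).trans ?_
        rw [hfst]
        change _ * det4 V0 X0 Y0 V0 + k.1 * deriv b₄ 0 * det4 Z0 X0 Y0 V0 = _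
        rw [hZ1, det4_alt3]; ring)
      hinj
      (by
        filter_upwards [hdet] with q hq k k1 k2
        rw [hld, dotL_apply] at k1 k2
        rw [hld, dotL_apply, hfst]
        have e := hq k V0
        rw [hfr.expand _ k1 k2, det4_add, det4_smul, det4_smul, det4_alt3, mul_zero,
          add_zero] at e
        exact e)
      (by
        filter_upwards [hdet] with q hq k k1 k2
        rw [hld, dotL_apply] at k1 k2
        rw [hld, dotL_apply, hfst]
        have e := hq k Z0
        rw [hfr.expand _ k1 k2, det4_add, det4_smul, det4_smul, det4_alt3, mul_zero,
          zero_add] at e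
        exact e)
      (by
        intro k k1 k2 k3
        rw [hld, dotL_apply, hdu] at k1
        rw [hld, dotL_apply, hdv] at k2
        rw [hfst] at k3
        rw [k3] at k1 k2
        intro e0
        have e1 := (fderiv_two hσs hα2 hb₄ hη2 hσp hsing₁ k).symm.trans e0
        rw [fderiv_sigma ha hb₃, k3] at e1
        change _ * det4 V0 X0 Y0 Z0 + _ = 0 at e1
        rw [hZ2] at e1
        simp only [zero_mul, zero_add] at k1 k2 e1
        rw [k1, k2] at e1
        norm_num at e1)
  exact finish (U := dotL X0) (V := dotL Y0) (L := dotL Z0) (M := dotL V0)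
    (fun y y1 y2 y3 y4 => by
      rw [dotL_apply] at y1 y2 y3 y4
      exact hfr.eq_zero y1 y2 y4 y3)
    (hl (dotL X0)) (hl (dotL Y0)) (fun _ => rfl) (fun _ => rfl) (fun _ => rfl) (fun _ => rfl)
    hinj h1 h2 h3 h4 h5 h6 h7 h8 h9 h10 h11 h12

theorem fderiv_g (q : ℝ × ℝ × ℝ) :
    DifferentiableAt ℝ (fun q : ℝ × ℝ × ℝ => (![q.1, q.2.1, q.2.2^2, q.1 * q.2.2] : E4)) q ∧
    ∀ k, fderiv ℝ (fun q : ℝ × ℝ × ℝ => (![q.1, q.2.1, q.2.2^2, q.1 * q.2.2] : E4)) q k =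
      ![k.1, k.2.1, 2 * q.2.2 * k.2.2, q.1 * k.2.2 + q.2.2 * k.1] := by
  have h1 : HasFDerivAt (fun p : ℝ × ℝ × ℝ => p.1)
    (ContinuousLinearMap.fst ℝ ℝ (ℝ × ℝ)) q :=
    (ContinuousLinearMap.fst ℝ ℝ (ℝ × ℝ)).hasFDerivAt
  have h2 : HasFDerivAt (fun p : ℝ × ℝ × ℝ => p.2.1)
    ((ContinuousLinearMap.fst ℝ ℝ ℝ).comp (ContinuousLinearMap.snd ℝ ℝ (ℝ × ℝ))) q :=
    ((ContinuousLinearMap.fst ℝ ℝ ℝ).comp (ContinuousLinearMap.snd ℝ ℝ (ℝ × ℝ))).hasFDerivAt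
  have h3 : HasFDerivAt (fun p : ℝ × ℝ × ℝ => p.2.2)
    ((ContinuousLinearMap.snd ℝ ℝ ℝ).comp (ContinuousLinearMap.snd ℝ ℝ (ℝ × ℝ))) q :=
    ((ContinuousLinearMap.snd ℝ ℝ ℝ).comp (ContinuousLinearMap.snd ℝ ℝ (ℝ × ℝ))).hasFDerivAt
  have hd : DifferentiableAt ℝ
      (fun q : ℝ × ℝ × ℝ => (![q.1, q.2.1, q.2.2^2, q.1 * q.2.2] : E4)) q := by
    rw [differentiableAt_pi]
    intro i
    fin_cases i
    · exact h1.differentiableAt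
    · exact h2.differentiableAt
    · exact (h3.pow 2).differentiableAt
    · exact (h1.mul h3).differentiableAt
  refine ⟨hd, fun k => ?_⟩
  have hd2 := hd.hasFDerivAt
  rw [hasFDerivAt_pi'] at hd2
  have d0 := DFunLike.congr_fun ((hd2 0).unique h1) k
  have d1 := DFunLike.congr_fun ((hd2 1).unique h2) k
  have d2 := DFunLike.congr_fun ((hd2 2).unique (h3.pow 2)) k
  have d3 := DFunLike.congr_fun ((hd2 3).unique (h1.mul h3)) k
  ext i
  fin_cases i
  · exact d0
  · exact d1
  · refine d2.trans ?_
    simp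
  · refine d3.trans ?_
    simp

theorem necessity {X Y : ℝ → E4} {a b₁ b₂ b₃ b₄ : ℝ → ℝ}
    (hX : ContDiff ℝ ∞ X) (hY : ContDiff ℝ ∞ Y)
    (ha : ContDiff ℝ ∞ a) (hb₁ : ContDiff ℝ ∞ b₁) (hb₂ : ContDiff ℝ ∞ b₂)
    (hb₃ : ContDiff ℝ ∞ b₃) (hb₄ : ContDiff ℝ ∞ b₄)
    (hfr : Frame (X 0) (Y 0) (deriv X 0))
    {F : ℝ × ℝ × ℝ → E4} (hFs : ContDiff ℝ ∞ F)
    {s r : ℝ}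
    (hFd : ∀ᶠ q in 𝓝 ((0, s, r) : ℝ × ℝ × ℝ), ∀ k, fderiv ℝ F q k =
      k.1 • (b₁ q.1 • X q.1 + b₂ q.1 • Y q.1 + (b₃ q.1 + q.2.1 + q.2.2 * a q.1) • deriv X q.1 +
        b₄ q.1 • tcross (X q.1) (Y q.1) (deriv X q.1)) + k.2.1 • X q.1 + k.2.2 • Y q.1)
    (hsing₁ : b₄ 0 = 0) (hsing₂ : b₃ 0 + s + r * a 0 = 0)
    (hA : AEquivAt F (0, s, r) (fun q => ![q.1, q.2.1, q.2.2^2, q.1 * q.2.2])) :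
    deriv b₄ 0 ≠ 0 := by
  intro hb0
  obtain ⟨φ, Φ, ⟨hφs, hφb⟩, ⟨hΦs, hΦb⟩, hφp, -, heq⟩ := hA
  set p : ℝ × ℝ × ℝ := (0, s, r) with hp
  set X0 := X 0
  set Y0 := Y 0
  set V0 := deriv X 0
  set Z0 := tcross X0 Y0 V0
  have hX' : ContDiff ℝ ∞ (deriv X) := hX.iterate_deriv 1
  have hZ : ContDiff ℝ ∞ fun t => tcross (X t) (Y t) (deriv X t) := contDiff_tcross hX hY hX'
  have hσs : ContDiff ℝ ∞ (fun q : ℝ × ℝ × ℝ => b₃ q.1 + q.2.1 + q.2.2 * a q.1) := by fun_prop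
  have hσp : (fun q : ℝ × ℝ × ℝ => b₃ q.1 + q.2.1 + q.2.2 * a q.1) p = 0 := hsing₂
  have e1 : b₃ p.1 + p.2.1 + p.2.2 * a p.1 = 0 := hsing₂
  have e2 : b₄ p.1 = 0 := hsing₁
  let H : ℝ × ℝ × ℝ → E4 := fun q => (b₃ q.1 + q.2.1 + q.2.2 * a q.1) • deriv X q.1 +
        b₄ q.1 • tcross (X q.1) (Y q.1) (deriv X q.1)
  have hHs : ContDiff ℝ ∞ H :=
    (hσs.smul (hX'.comp contDiff_fst)).add ((hb₄.smul hZ).comp contDiff_fst)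
  have hHp : H p = 0 := by simp only [H]; rw [e1, e2]; simp
  have hHd : HasFDerivAt H (fderiv ℝ H p) p := (hHs.differentiable (by simp) p).hasFDerivAt
  let ξ : ℝ × ℝ × ℝ → ℝ × ℝ × ℝ := fun q => (1, - b₁ q.1, - b₂ q.1)
  have hξ : ContDiff ℝ ∞ ξ := by simp only [ξ]; fun_prop
  have hFξ : ∀ᶠ q in 𝓝 p, fderiv ℝ F q (ξ q) = H q := by
    filter_upwards [hFd] with q hq
    rw [hq]
    simp only [ξ, H, one_smul, neg_smul]
    abel
  have hΦ2 : ∀ᶠ y in 𝓝 (F p), DifferentiableAt ℝ Φ y := by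
    have h1 : ContDiffAt ℝ 1 Φ (F p) := hΦs.of_le (by exact_mod_cast le_top)
    filter_upwards [h1.eventually (by simp)] with y hy using hy.differentiableAt (by simp)
  have hφ2 : ∀ᶠ y in 𝓝 p, DifferentiableAt ℝ φ y := by
    have h1 : ContDiffAt ℝ 1 φ p := hφs.of_le (by exact_mod_cast le_top)
    filter_upwards [h1.eventually (by simp)] with y hy using hy.differentiableAt (by simp)
  have hΦd : DifferentiableAt ℝ (fderiv ℝ Φ) (F p) :=
    (hΦs.fderiv_right (m := ∞) (by simp)).differentiableAt (by simp)
  have hφd : DifferentiableAt ℝ (fderiv ℝ φ) p :=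
    (hφs.fderiv_right (m := ∞) (by simp)).differentiableAt (by simp)
  have hFdiff := hFs.differentiable (by simp)
  -- chain rule
  have hchain : ∀ᶠ q in 𝓝 p, ∀ k, fderiv ℝ Φ (F q) (fderiv ℝ F q k) =
      ![(fderiv ℝ φ q k).1, (fderiv ℝ φ q k).2.1, 2 * (φ q).2.2 * (fderiv ℝ φ q k).2.2,
        (φ q).1 * (fderiv ℝ φ q k).2.2 + (φ q).2.2 * (fderiv ℝ φ q k).1] := by
    filter_upwards [eventually_eventually_nhds.2 heq,
      (hFdiff p).continuousAt.eventually hΦ2, hφ2] with q h1 h2 h3 k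
    have a1 := h2.hasFDerivAt.comp q (hFdiff q).hasFDerivAt
    have a2 := (fderiv_g (φ q)).1.hasFDerivAt.comp q h3.hasFDerivAt
    have a3 := DFunLike.congr_fun (a1.unique (a2.congr_of_eventuallyEq h1)) k
    rw [← (fderiv_g (φ q)).2]
    exact a3
  let w : ℝ × ℝ × ℝ → ℝ × ℝ × ℝ := fun q => fderiv ℝ φ q (ξ q)
  have hwd : HasFDerivAt w (fderiv ℝ w p) p := by
    have : DifferentiableAt ℝ w p := hφd.clm_apply (hξ.differentiable (by simp) p)
    exact this.hasFDerivAt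
  have hmain : ∀ᶠ q in 𝓝 p, fderiv ℝ Φ (F q) (H q) =
      ![(w q).1, (w q).2.1, 2 * (φ q).2.2 * (w q).2.2,
        (φ q).1 * (w q).2.2 + (φ q).2.2 * (w q).1] := by
    filter_upwards [hchain, hFξ] with q h1 h2
    rw [← h2, h1]
  have hw1 : (w p).1 = 0 := by
    have := congrFun hmain.self_of_nhds 0
    rw [hHp, map_zero] at this
    exact this.symm
  have hw2 : (w p).2.1 = 0 := by
    have := congrFun hmain.self_of_nhds 1
    rw [hHp, map_zero] at this
    exact this.symm
  have hw3 : (w p).2.2 ≠ 0 := by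
    intro h
    have hw0 : fderiv ℝ φ p (ξ p) = 0 := by
      change w p = 0
      ext <;> assumption
    have := hφb.1 (hw0.trans (map_zero _).symm)
    have := congrArg Prod.fst this
    simp [ξ] at this
  set c := (w p).2.2 with hcdef
  -- differentiate at p
  have hLd : HasFDerivAt (fun q => fderiv ℝ Φ (F q) (H q))
      ((fderiv ℝ Φ (F p)).comp (fderiv ℝ H p)) p := by
    have h1 := (hΦd.hasFDerivAt.comp p (hFdiff p).hasFDerivAt).clm_apply hHd
    refine h1.congr_fderiv ?_
    refine ContinuousLinearMap.ext fun k => ?_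
    simp [hHp]
  have hcomp := hasFDerivAt_pi'.1 hLd
  have hφp' : HasFDerivAt φ (fderiv ℝ φ p) p := hφ2.self_of_nhds.hasFDerivAt
  have hφ1 : HasFDerivAt (fun q => (φ q).1) _ p := hφp'.fst
  have hφ3 : HasFDerivAt (fun q => (φ q).2.2) _ p := hφp'.snd.snd
  have hu1 : HasFDerivAt (fun q => (w q).1) _ p := hwd.fst
  have hu3 : HasFDerivAt (fun q => (w q).2.2) _ p := hwd.snd.snd
  have c2 : ∀ k, fderiv ℝ Φ (F p) (fderiv ℝ H p k) 2 = 2 * c * (fderiv ℝ φ p k).2.2 := by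
    intro k
    have a1 := (hφ3.const_mul 2).mul hu3
    have a2 := DFunLike.congr_fun ((hcomp 2).unique (a1.congr_of_eventuallyEq (by
      filter_upwards [hmain] with q hq
      rw [hq]; rfl))) k
    refine Eq.trans (by rfl) (a2.trans ?_)
    simp [hφp]
    ring
  have c3 : ∀ k, fderiv ℝ Φ (F p) (fderiv ℝ H p k) 3 = c * (fderiv ℝ φ p k).1 := by
    intro k
    have a1 := (hφ1.mul hu3).add (hφ3.mul hu1)
    have a2 := DFunLike.congr_fun ((hcomp 3).unique (a1.congr_of_eventuallyEq (by
      filter_upwards [hmain] with q hq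
      rw [hq]; rfl))) k
    refine Eq.trans (by rfl) (a2.trans ?_)
    simp [hφp, hw1]
    exact Or.inl rfl
  obtain ⟨k2, hk2⟩ := hφb.2 (fderiv ℝ Φ (F p) Z0 3 / c, 0, fderiv ℝ Φ (F p) Z0 2 / (2 * c))
  obtain ⟨k1, hk1⟩ := hφb.2 ((fderiv ℝ Φ (F p) (Z0 - fderiv ℝ H p k2)) 0,
    (fderiv ℝ Φ (F p) (Z0 - fderiv ℝ H p k2)) 1, 0)
  have hZeq : fderiv ℝ F p k1 = Z0 - fderiv ℝ H p k2 := by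
    apply hΦb.1
    rw [hchain.self_of_nhds, hφp, hk1]
    ext i
    fin_cases i
    · rfl
    · rfl
    · simp [c2, hk2]
      field_simp
      ring
    · simp [c3, hk2]
      field_simp
      ring
  -- pair with Z0
  have hdF : dot4 (fderiv ℝ F p k1) Z0 = 0 := by
    rw [hFd.self_of_nhds k1, e1, e2]
    simp only [dot4_add, dot4_smul, zero_smul, add_zero]
    change k1.1 * (b₁ 0 * dot4 X0 Z0 + b₂ 0 * dot4 Y0 Z0) + k1.2.1 * dot4 X0 Z0
      + k1.2.2 * dot4 Y0 Z0 = _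
    rw [Frame.az, Frame.bz]; ring
  have hdH : dot4 (fderiv ℝ H p k2) Z0 = 0 := by
    have s1 : ContDiff ℝ ∞ fun t => dotL Z0 (deriv X t) := (dotL Z0).contDiff.comp hX'
    have s2 : ContDiff ℝ ∞ fun t => dotL Z0 (tcross (X t) (Y t) (deriv X t)) :=
      (dotL Z0).contDiff.comp hZ
    have a1 := fderiv_two hσs s1 hb₄ s2 hσp hsing₁ k2
    have a2 : HasFDerivAt (fun q => dotL Z0 (H q)) ((dotL Z0).comp (fderiv ℝ H p)) p :=
      (dotL Z0).hasFDerivAt.comp p hHd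
    have a3 : (fun q => dotL Z0 (H q)) = fun q : ℝ × ℝ × ℝ =>
        (b₃ q.1 + q.2.1 + q.2.2 * a q.1) * dotL Z0 (deriv X q.1) +
        b₄ q.1 * dotL Z0 (tcross (X q.1) (Y q.1) (deriv X q.1)) := by
      ext q
      simp only [H, map_add, map_smul, smul_eq_mul]
    rw [← a3, a2.fderiv] at a1
    have a4 : dotL Z0 (deriv X p.1) = 0 := by
      rw [dotL_apply]; exact Frame.cz
    have a5 : deriv b₄ p.1 = 0 := hb0
    rw [a4, a5] at a1
    rw [← dotL_apply]
    refine Eq.trans (by rfl) (a1.trans ?_)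
    ring
  rw [hZeq, dot4_sub, hdH] at hdF
  have := hfr.zz
  rw [this] at hdF
  norm_num at hdF

end Helpers

/-- A pseudo-non-degenerate two-ruled hypersurface (normalized) is a Whitney umbrella ×
interval at a singular point `p = (0,s,r)` iff `b₄` is not identically zero near `0`
and `b₄'(0) ≠ 0`. -/
theorem stmt16 (γ X Y : ℝ → E4) (a b₁ b₂ b₃ b₄ : ℝ → ℝ)
    (hγ : ContDiff ℝ (⊤ : ℕ∞) γ) (hX : ContDiff ℝ (⊤ : ℕ∞) X) (hY : ContDiff ℝ (⊤ : ℕ∞) Y)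
    (ha : ContDiff ℝ (⊤ : ℕ∞) a) (hb₁ : ContDiff ℝ (⊤ : ℕ∞) b₁) (hb₂ : ContDiff ℝ (⊤ : ℕ∞) b₂)
    (hb₃ : ContDiff ℝ (⊤ : ℕ∞) b₃) (hb₄ : ContDiff ℝ (⊤ : ℕ∞) b₄)
    -- constrictively adapted director curves
    (hXunit : ∀ᶠ t in 𝓝 (0:ℝ), dot4 (X t) (X t) = 1)
    (hYunit : ∀ᶠ t in 𝓝 (0:ℝ), dot4 (Y t) (Y t) = 1)
    (hXY : ∀ᶠ t in 𝓝 (0:ℝ), dot4 (X t) (Y t) = 0)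
    (hXY' : ∀ᶠ t in 𝓝 (0:ℝ), dot4 (X t) (deriv Y t) = 0)
    -- normalization
    (hspan : ∀ᶠ t in 𝓝 (0:ℝ), LinearIndependent ℝ ![X t, Y t, deriv X t])
    (hX'unit : ∀ᶠ t in 𝓝 (0:ℝ), dot4 (deriv X t) (deriv X t) = 1)
    -- structure functions
    (hY' : ∀ᶠ t in 𝓝 (0:ℝ), deriv Y t = a t • deriv X t)
    (hγ' : ∀ᶠ t in 𝓝 (0:ℝ), deriv γ t =
      b₁ t • X t + b₂ t • Y t + b₃ t • deriv X t +
        b₄ t • tcross (X t) (Y t) (deriv X t))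
    (F : ℝ × ℝ × ℝ → E4)
    (hF : F = fun p => γ p.1 + p.2.1 • X p.1 + p.2.2 • Y p.1)
    (s r : ℝ)
    -- p = (0,s,r) is a singular point
    (hsing₁ : b₄ 0 = 0)
    (hsing₂ : b₃ 0 + s + r * a 0 = 0) :
    AEquivAt F (0, s, r) (fun q => ![q.1, q.2.1, q.2.2^2, q.1 * q.2.2]) ↔
      ((¬ ∀ᶠ t in 𝓝 (0:ℝ), b₄ t = 0) ∧ deriv b₄ 0 ≠ 0) := by
  have hfr := frame_zero hX hY hXunit hYunit hXY hXY' hX'unit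
  have hFs : ContDiff ℝ (⊤ : ℕ∞) F := by
    rw [hF]; fun_prop
  have hFd : ∀ᶠ q in 𝓝 ((0, s, r) : ℝ × ℝ × ℝ), ∀ k, fderiv ℝ F q k =
      k.1 • (b₁ q.1 • X q.1 + b₂ q.1 • Y q.1 + (b₃ q.1 + q.2.1 + q.2.2 * a q.1) • deriv X q.1 +
        b₄ q.1 • tcross (X q.1) (Y q.1) (deriv X q.1)) + k.2.1 • X q.1 + k.2.2 • Y q.1 := by
    have ht : Tendsto (fun q : ℝ × ℝ × ℝ => q.1) (𝓝 (0, s, r)) (𝓝 0) :=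
      continuous_fst.tendsto (0, s, r)
    filter_upwards [ht.eventually hγ', ht.eventually hY'] with q h1 h2 k
    rw [hF, fderiv_F hγ hX hY, h1, h2]
    module
  constructor
  · intro hA
    have hne := necessity hX hY ha hb₁ hb₂ hb₃ hb₄ hfr hFs hFd hsing₁ hsing₂ hA
    refine ⟨fun h => hne ?_, hne⟩
    have : b₄ =ᶠ[𝓝 0] fun _ => 0 := h
    rw [this.deriv_eq]; simp
  · rintro ⟨-, hne⟩
    exact sufficiency hX hY ha hb₃ hb₄ hfr hFs hFd hsing₁ hsing₂ hne
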